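/- arXiv:1510.07661 — 4 statements merged into one kernel-verified Lean document; each statement's English description precedes it below -/
import Mathlib

section
/- Let d be a positive integer and q a prime power with q ≡ 1 (mod d), set t = (q−1)/d, and let T be a generator of the group of multiplicative characters of F_q^×. Then for every integer j, Π_{i=0}^{d−1} g(T^{it+j}) = g(T^{dj}) · T^{−dj}(d) · Π_{i=1}^{d−1} g(T^{it}). -/
/-- The standard additive character of a finite field `F` of characteristic `p`,
built from a primitive `p`-th root of unity `ζ` in `ℂ`:  `θ x = ζ ^ tr(x)`. -/
noncomputable def stdAddChar {F : Type*} [Field F] [Fintype F] (p : ℕ) [CharP F p]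
    [Algebra (ZMod p) F] (ζ : ℂ) (x : F) : ℂ :=
  ζ ^ (Algebra.trace (ZMod p) F x).val

/-- The Gauss sum `g(χ) = ∑ₓ χ(x) θ(x)` with respect to the standard additive character. -/
noncomputable def gaussSum' {F : Type*} [Field F] [Fintype F] (p : ℕ) [CharP F p]
    [Algebra (ZMod p) F] (ζ : ℂ) (χ : MulChar F ℂ) : ℂ :=
  ∑ x : F, χ x * stdAddChar p ζ x

namespace PowerSeries

lemma eq_of_X_mul_derivative_eq {K : Type*} [Field K] [CharZero K] {A B S : K⟦X⟧}
    (hA : X * d⁄dX K A = S * A) (hB : X * d⁄dX K B = S * B)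
    (hA0 : constantCoeff A = 1) (hB0 : constantCoeff B = 1) : A = B := by
  have hne : constantCoeff B ≠ 0 := by simp [hB0]
  have hX : d⁄dX K A * B = A * d⁄dX K B := by
    apply mul_left_cancel₀ (X_ne_zero (R := K))
    linear_combination B * hA - A * hB
  have h : A * B⁻¹ = 1 := by
    apply derivative.ext
    · have hB1 := PowerSeries.mul_inv_cancel B hne
      rw [Derivation.leibniz, derivative_inv', smul_eq_mul, smul_eq_mul, Derivation.map_one_eq_zero]
      linear_combination B⁻¹ ^ 2 * hX - d⁄dX K A * B⁻¹ * hB1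
    · simp [hA0, hB0]
  rw [← mul_one A, ← PowerSeries.inv_mul_cancel B hne, ← mul_assoc, h, one_mul]

lemma X_mul_derivative_prod {K ι : Type*} [Field K] (s : Finset ι) {A S : ι → K⟦X⟧}
    (h : ∀ i ∈ s, X * d⁄dX K (A i) = S i * A i) :
    X * d⁄dX K (∏ i ∈ s, A i) = (∑ i ∈ s, S i) * ∏ i ∈ s, A i := by
  classical
  induction s using Finset.induction_on with
  | empty => simp
  | insert i s hi ih =>
    rw [Finset.prod_insert hi, Finset.sum_insert hi, Derivation.leibniz, smul_eq_mul, smul_eq_mul]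
    linear_combination A i * ih (fun k hk => h k (Finset.mem_insert_of_mem hk)) +
      (∏ k ∈ s, A k) * h i (Finset.mem_insert_self i s)

lemma coeff_card_prod_one_add_C_mul_X {K ι : Type*} [Field K] (s : Finset ι)
    (g : ι → K) :
    coeff s.card (∏ i ∈ s, (1 + C (g i) * X : K⟦X⟧)) = ∏ i ∈ s, g i := by
  have hcoe : ∏ i ∈ s, (1 + C (g i) * X : K⟦X⟧) =
      ((∏ i ∈ s, (1 + Polynomial.C (g i) * Polynomial.X) : Polynomial K) : K⟦X⟧) := by
    rw [← Polynomial.coeToPowerSeries.ringHom_apply, map_prod]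
    simp
  have hdeg (i : ι) : (1 + Polynomial.C (g i) * Polynomial.X : Polynomial K).natDegree ≤ 1 := by
    compute_degree
  have := Polynomial.coeff_prod_of_natDegree_le s _ 1 fun i _ => hdeg i
  rw [mul_one] at this
  rw [hcoe, Polynomial.coeff_coe, this]
  simp [Polynomial.coeff_one]

end PowerSeries

namespace Polynomial

/-- The `m`-th power sum of the roots of a polynomial, read off from the logarithmic derivative of
its reversal. -/
noncomputable def rootPowerSum {K : Type*} [Field K] (m : ℕ) (f : K[X]) : K :=
  PowerSeries.coeff m
    (-(PowerSeries.X * PowerSeries.derivative K (f.reverse : PowerSeries K) *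
      (f.reverse : PowerSeries K)⁻¹))

section

variable {K : Type*} [Field K]

lemma constantCoeff_coe_reverse (f : K[X]) :
    PowerSeries.constantCoeff (f.reverse : PowerSeries K) = f.leadingCoeff := by
  simp [← PowerSeries.coeff_zero_eq_constantCoeff_apply]

lemma coe_reverse_mul_inv {f : K[X]} (hf : f ≠ 0) :
    (f.reverse : PowerSeries K) * (f.reverse : PowerSeries K)⁻¹ = 1 :=
  PowerSeries.mul_inv_cancel _ (by simpa [constantCoeff_coe_reverse] using hf)

lemma rootPowerSum_eq_coeff {f : K[X]} (hf : f ≠ 0) {s : PowerSeries K}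
    (hs : (f.reverse : PowerSeries K) * s =
      -(PowerSeries.X * PowerSeries.derivative K (f.reverse : PowerSeries K))) (m : ℕ) :
    rootPowerSum m f = PowerSeries.coeff m s := by
  rw [rootPowerSum]
  congr 1
  linear_combination (f.reverse : PowerSeries K)⁻¹ * (-hs) + s * coe_reverse_mul_inv hf

lemma coe_reverse_mul_mk_rootPowerSum {f : K[X]} (hf : f ≠ 0) :
    (f.reverse : PowerSeries K) * PowerSeries.mk (fun m => rootPowerSum m f) =
      -(PowerSeries.X * PowerSeries.derivative K (f.reverse : PowerSeries K)) := by
  have : PowerSeries.mk (fun m => rootPowerSum m f) =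
    (-(PowerSeries.X * PowerSeries.derivative K (f.reverse : PowerSeries K) *
      (f.reverse : PowerSeries K)⁻¹)) := by
    ext m; simp [rootPowerSum]
  rw [this]
  linear_combination (-(PowerSeries.X * PowerSeries.derivative K (f.reverse : PowerSeries K))) *
    coe_reverse_mul_inv hf

lemma rootPowerSum_mul (m : ℕ) {f g : K[X]} (hf : f ≠ 0) (hg : g ≠ 0) :
    rootPowerSum m (f * g) = rootPowerSum m f + rootPowerSum m g := by
  rw [rootPowerSum_eq_coeff (mul_ne_zero hf hg)
    (s := PowerSeries.mk (fun m => rootPowerSum m f) + PowerSeries.mk (fun m => rootPowerSum m g))]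
  · simp
  · rw [reverse_mul_of_domain, coe_mul, Derivation.leibniz]
    simp only [smul_eq_mul]
    linear_combination (g.reverse : PowerSeries K) * coe_reverse_mul_mk_rootPowerSum hf +
      (f.reverse : PowerSeries K) * coe_reverse_mul_mk_rootPowerSum hg

@[simp]
lemma rootPowerSum_one (m : ℕ) : rootPowerSum m (1 : K[X]) = 0 := by
  have hr : (1 : K[X]).reverse = 1 := by rw [← C_1, reverse_C]
  rw [rootPowerSum_eq_coeff one_ne_zero (s := 0)]
  · simp
  · rw [hr]
    simp

lemma rootPowerSum_prod (m : ℕ) {ι : Type*} (s : Finset ι) {f : ι → K[X]} (hf : ∀ i ∈ s, f i ≠ 0) :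
    rootPowerSum m (∏ i ∈ s, f i) = ∑ i ∈ s, rootPowerSum m (f i) := by
  classical
  induction s using Finset.induction_on with
  | empty => simp
  | insert a s ha ih =>
    rw [Finset.prod_insert ha, Finset.sum_insert ha, rootPowerSum_mul m (hf a (by simp))
      (Finset.prod_ne_zero_iff.mpr fun i hi => hf i (by simp [hi])),
      ih fun i hi => hf i (by simp [hi])]

lemma rootPowerSum_X_sub_C {m : ℕ} (hm : m ≠ 0) (a : K) : rootPowerSum m (X - C a) = a ^ m := by
  have hr : (X - C a).reverse = 1 - C a * X := by
    ext i
    rw [coeff_reverse, natDegree_X_sub_C]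
    rcases i with _ | _ | i
    · simp [revAt_le]
    · simp [revAt_le, coeff_one]
    · rw [revAt_eq_self_of_lt (by omega)]
      simp [coeff_X, coeff_one]
  rw [rootPowerSum_eq_coeff (X_sub_C_ne_zero a)
    (s := PowerSeries.X * PowerSeries.mk fun i => a ^ (i + 1))]
  · obtain ⟨m, rfl⟩ := Nat.exists_eq_succ_of_ne_zero hm
    rw [Nat.succ_eq_add_one, PowerSeries.coeff_succ_X_mul, PowerSeries.coeff_mk]
  · rw [hr, mul_left_comm, ← mul_neg]
    congr 1
    rw [PowerSeries.derivative_coe]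
    ext i
    simp only [coe_sub, coe_one, coe_mul, coe_C, coe_X, sub_mul, one_mul, mul_assoc, map_sub]
    rcases i with _ | i
    · simp 
    · simp [PowerSeries.coeff_succ_X_mul, pow_succ']

lemma rootPowerSum_map (m : ℕ) {L : Type*} [Field L] (φ : K →+* L) {f : K[X]} (hf : f ≠ 0) :
    rootPowerSum m (f.map φ) = φ (rootPowerSum m f) := by
  have hr : ((f.map φ).reverse : PowerSeries L) = PowerSeries.map φ (f.reverse : PowerSeries K) := by
    ext i
    simp [coeff_reverse]
  rw [rootPowerSum_eq_coeff ((Polynomial.map_ne_zero_iff φ.injective).mpr hf)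
    (s := PowerSeries.map φ (PowerSeries.mk (fun m => rootPowerSum m f)))]
  · simp
  · rw [hr, ← map_mul, coe_reverse_mul_mk_rootPowerSum hf]
    ext i
    rcases i with _ | i
    · simp
    · simp [PowerSeries.coeff_succ_X_mul, PowerSeries.coeff_derivative]

/-- Newton's identity. -/
lemma rootPowerSum_succ (m : ℕ) {f : K[X]} (hf : f.Monic) :
    rootPowerSum (m + 1) f = -((m + 1 : ℕ) : K) * f.reverse.coeff (m + 1) -
      ∑ i ∈ Finset.range m, f.reverse.coeff (i + 1) * rootPowerSum (m - i) f := by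
  have h := congrArg (PowerSeries.coeff (m + 1)) (coe_reverse_mul_mk_rootPowerSum hf.ne_zero)
  rw [map_neg, PowerSeries.coeff_succ_X_mul, PowerSeries.coeff_derivative, PowerSeries.coeff_mul,
    Finset.Nat.sum_antidiagonal_eq_sum_range_succ_mk, Finset.sum_range_succ',
    Finset.sum_range_succ] at h
  have h0 : rootPowerSum 0 f = 0 := by simp [rootPowerSum]
  simp [hf.leadingCoeff, h0] at h
  push_cast
  linear_combination h

lemma rootPowerSum_congr {m : ℕ} {f g : K[X]} (hf : f.Monic) (hg : g.Monic)
    (h : ∀ i ≤ m, f.reverse.coeff i = g.reverse.coeff i) :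
    rootPowerSum m f = rootPowerSum m g := by
  induction m using Nat.strong_induction_on with
  | _ m ih =>
    rcases m with _ | m
    · simp [rootPowerSum]
    · rw [rootPowerSum_succ m hf, rootPowerSum_succ m hg, h _ le_rfl]
      congr 1
      refine Finset.sum_congr rfl fun i hi => ?_
      have := Finset.mem_range.mp hi
      rw [h (i + 1) (by omega), ih (m - i) (by omega) fun j hj => h j (by omega)]

lemma rootPowerSum_add_C_mul_X_pow {n m : ℕ} {f : K[X]} (hf : f.Monic) (hn : f.natDegree = n + m)
    (hm : m ≠ 0) (a : K) :
    rootPowerSum m (f + C a * X ^ n) = rootPowerSum m f - m * a := by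
  obtain ⟨m, rfl⟩ := Nat.exists_eq_succ_of_ne_zero hm
  have hlt : (C a * X ^ n).degree < f.degree := by
    rw [degree_eq_natDegree hf.ne_zero, hn]
    refine (degree_C_mul_X_pow_le n a).trans_lt ?_
    exact_mod_cast (by omega : n < n + m.succ)
  have hf' : (f + C a * X ^ n).Monic := hf.add_of_left hlt
  have hd : (f + C a * X ^ n).natDegree = n + m.succ := by
    rw [natDegree_add_eq_left_of_degree_lt hlt, hn]
  have hc : ∀ i ≤ m, (f + C a * X ^ n).reverse.coeff i = f.reverse.coeff i := by
    intro i hi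
    rw [coeff_reverse, coeff_reverse, hd, hn, revAt_le (by omega), coeff_add, coeff_C_mul_X_pow,
      if_neg (by omega), add_zero]
  rw [rootPowerSum_succ m hf, rootPowerSum_succ m hf', coeff_reverse, coeff_reverse f, hd, hn,
    revAt_le (by omega), coeff_add, coeff_C_mul_X_pow, if_pos (by omega)]
  rw [Finset.sum_congr rfl fun i hi => ?_]
  · ring
  · have := Finset.mem_range.mp hi
    rw [hc _ (by omega), rootPowerSum_congr hf' hf fun j hj => hc j (by omega)]

end

end Polynomial

section HasseDavenport

open Polynomial

section MonicPolynomials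

variable (F : Type*) [Field F] [Fintype F]

lemma Polynomial.finite_setOf_monic_natDegree_le (n : ℕ) :
    {f : F[X] | f.Monic ∧ f.natDegree ≤ n}.Finite := by
  have : Finite (degreeLT F (n + 1)) := Finite.of_equiv _ (degreeLTEquiv F (n + 1)).toEquiv.symm
  refine (Set.toFinite (degreeLT F (n + 1) : Set F[X])).subset fun f hf => ?_
  rw [SetLike.mem_coe, mem_degreeLT]
  exact (natDegree_lt_iff_degree_lt hf.1.ne_zero).mp (Nat.lt_succ_of_le hf.2)

/-- The monic polynomials of degree `n` over a finite field. -/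
noncomputable def monicsOfDegree (n : ℕ) : Finset F[X] :=
  {f ∈ (finite_setOf_monic_natDegree_le F n).toFinset | f.natDegree = n}

/-- The monic irreducible polynomials of degree at most `n` over a finite field. -/
noncomputable def irreducibleMonicsUpTo (n : ℕ) : Finset F[X] :=
  open Classical in {f ∈ (finite_setOf_monic_natDegree_le F n).toFinset | Irreducible f}

variable {F}

@[simp]
lemma mem_monicsOfDegree {n : ℕ} {f : F[X]} :
    f ∈ monicsOfDegree F n ↔ f.Monic ∧ f.natDegree = n := by
  simp only [monicsOfDegree, Finset.mem_filter, Set.Finite.mem_toFinset, Set.mem_ofPred_eq]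
  grind

@[simp]
lemma mem_irreducibleMonicsUpTo {n : ℕ} {f : F[X]} :
    f ∈ irreducibleMonicsUpTo F n ↔ f.Monic ∧ Irreducible f ∧ f.natDegree ≤ n := by
  simp only [irreducibleMonicsUpTo, Finset.mem_filter, Set.Finite.mem_toFinset, Set.mem_ofPred_eq]
  grind

open Classical UniqueFactorizationMonoid in
lemma sum_natDegree_of_pow_dvd {n : ℕ} {h : F[X]} (hh : h ∈ monicsOfDegree F n) :
    ∑ P ∈ irreducibleMonicsUpTo F n, ∑ m ∈ Finset.Icc 1 n with P ^ m ∣ h, P.natDegree = n := by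
  classical
  obtain ⟨hm, hn⟩ := mem_monicsOfDegree.mp hh
  set s := normalizedFactors h with hs
  have hprod : s.prod = h := by
    rw [hs, prod_normalizedFactors_eq hm.ne_zero, hm.normalize_eq_self]
  have hmonic : ∀ P ∈ s, P.Monic := fun P hP => by
    rw [← normalize_normalized_factor P hP]
    exact monic_normalize (irreducible_of_normalized_factor P hP).ne_zero
  have hsub : s.toFinset ⊆ irreducibleMonicsUpTo F n := fun P hP => by
    rw [Multiset.mem_toFinset] at hP
    exact mem_irreducibleMonicsUpTo.mpr ⟨hmonic P hP, irreducible_of_normalized_factor P hP,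
      hn ▸ natDegree_le_of_dvd (dvd_of_mem_normalizedFactors hP) hm.ne_zero⟩
  have hdeg : (s.map natDegree).sum = n := by
    rw [← natDegree_multiset_prod_of_monic s hmonic, hprod, hn]
  refine Eq.trans ?_ hdeg
  rw [Finset.sum_multiset_map_count, Finset.sum_subset hsub fun P _ hP => by
    rw [Multiset.count_eq_zero.mpr (by simpa using hP), zero_smul]]
  refine Finset.sum_congr rfl fun P hP => ?_
  obtain ⟨hPm, hPi, -⟩ := mem_irreducibleMonicsUpTo.mp hP
  have hdvd (m : ℕ) : P ^ m ∣ h ↔ m ≤ s.count P := by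
    rw [pow_dvd_iff_le_emultiplicity, emultiplicity_eq_count_normalizedFactors hPi hm.ne_zero,
      hPm.normalize_eq_self, Nat.cast_le]
  have hle : s.count P ≤ n := by
    have := natDegree_le_of_dvd ((hdvd _).mpr le_rfl) hm.ne_zero
    rw [natDegree_pow, hn] at this
    exact (Nat.le_mul_of_pos_right _ hPi.natDegree_pos).trans this
  rw [Finset.sum_const]
  congr 1
  have : (Finset.Icc 1 n).filter (fun m => P ^ m ∣ h) = Finset.Icc 1 (s.count P) := by
    ext m
    simp only [Finset.mem_filter, Finset.mem_Icc, hdvd]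
    omega
  rw [this, Nat.card_Icc, Nat.add_sub_cancel]

variable {μ : F[X] → ℂ}

open Classical in
lemma sum_monicsOfDegree_of_dvd (hμ : ∀ f g : F[X], f.Monic → g.Monic → μ (f * g) = μ f * μ g)
    {n : ℕ} {Q : F[X]} (hQ : Q.Monic) (hn : Q.natDegree ≤ n) :
    ∑ h ∈ monicsOfDegree F n with Q ∣ h, μ h =
      μ Q * ∑ h ∈ monicsOfDegree F (n - Q.natDegree), μ h := by
  classical
  rw [Finset.mul_sum]
  symm
  refine Finset.sum_bij (fun h _ => Q * h) ?_ ?_ ?_ ?_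
  · intro h hh
    obtain ⟨hm, hd⟩ := mem_monicsOfDegree.mp hh
    simp only [Finset.mem_filter, mem_monicsOfDegree, dvd_mul_right, and_true]
    exact ⟨hQ.mul hm, by rw [hQ.natDegree_mul hm]; omega⟩
  · intro a _ b _ hab
    exact mul_left_cancel₀ hQ.ne_zero hab
  · intro h hh
    simp only [Finset.mem_filter, mem_monicsOfDegree] at hh
    obtain ⟨⟨hm, hd⟩, g, rfl⟩ := hh
    have hg : g.Monic := hQ.of_mul_monic_left hm
    refine ⟨g, mem_monicsOfDegree.mpr ⟨hg, ?_⟩, rfl⟩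
    rw [hQ.natDegree_mul hg] at hd
    omega
  · intro h hh
    exact (hμ _ _ hQ (mem_monicsOfDegree.mp hh).1).symm

/-- The coefficients `c n` of the `L`-series `∑ μ(h) X ^ deg h` of a completely multiplicative
function on monic polynomials satisfy Newton's identities with respect to the coefficients of its
logarithmic derivative. -/
lemma natCast_mul_sum_monicsOfDegree (hμ1 : μ 1 = 1)
    (hμ : ∀ f g : F[X], f.Monic → g.Monic → μ (f * g) = μ f * μ g) (n : ℕ) :
    (n : ℂ) * ∑ h ∈ monicsOfDegree F n, μ h =
      ∑ k ∈ Finset.Icc 1 n,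
        (∑ P ∈ irreducibleMonicsUpTo F n with P.natDegree ∣ k,
          (P.natDegree : ℂ) * μ P ^ (k / P.natDegree)) *
        ∑ h ∈ monicsOfDegree F (n - k), μ h := by
  classical
  have hpow (P : F[X]) (hP : P.Monic) (m : ℕ) : μ (P ^ m) = μ P ^ m := by
    induction m with
    | zero => simp [hμ1]
    | succ m ih => rw [pow_succ, pow_succ, hμ _ _ (hP.pow m) hP, ih]
  calc (n : ℂ) * ∑ h ∈ monicsOfDegree F n, μ h
      = ∑ h ∈ monicsOfDegree F n, ∑ P ∈ irreducibleMonicsUpTo F n, ∑ m ∈ Finset.Icc 1 n,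
          if P ^ m ∣ h then (P.natDegree : ℂ) * μ h else 0 := by
        rw [Finset.mul_sum]
        refine Finset.sum_congr rfl fun h hh => ?_
        conv_lhs => rw [← sum_natDegree_of_pow_dvd hh]
        push_cast
        simp only [Finset.sum_mul, Finset.sum_filter, ite_mul, zero_mul]
    _ = ∑ P ∈ irreducibleMonicsUpTo F n, ∑ m ∈ Finset.Icc 1 n,
          ∑ h ∈ monicsOfDegree F n, if P ^ m ∣ h then (P.natDegree : ℂ) * μ h else 0 := by
        rw [Finset.sum_comm]
        refine Finset.sum_congr rfl fun P _ => Finset.sum_comm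
    _ = ∑ P ∈ irreducibleMonicsUpTo F n, ∑ m ∈ Finset.Icc 1 n with m * P.natDegree ≤ n,
          (P.natDegree : ℂ) * μ P ^ m * ∑ h ∈ monicsOfDegree F (n - m * P.natDegree), μ h := by
        refine Finset.sum_congr rfl fun P hP => ?_
        have hPm := (mem_irreducibleMonicsUpTo.mp hP).1
        rw [Finset.sum_filter]
        refine Finset.sum_congr rfl fun m _ => ?_
        have hd : (P ^ m).natDegree = m * P.natDegree := hPm.natDegree_pow m
        rw [← Finset.sum_filter, ← Finset.mul_sum]
        split_ifs with hle
        · rw [sum_monicsOfDegree_of_dvd hμ (hPm.pow m) (hd ▸ hle), hd, hpow P hPm, mul_assoc]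
        · rw [Finset.filter_false_of_mem, Finset.sum_empty, mul_zero]
          intro h hh hdvd
          obtain ⟨hm, hn⟩ := mem_monicsOfDegree.mp hh
          have := natDegree_le_of_dvd hdvd hm.ne_zero
          omega
    _ = ∑ P ∈ irreducibleMonicsUpTo F n, ∑ k ∈ Finset.Icc 1 n with P.natDegree ∣ k,
          (P.natDegree : ℂ) * μ P ^ (k / P.natDegree) * ∑ h ∈ monicsOfDegree F (n - k), μ h := by
        refine Finset.sum_congr rfl fun P hP => ?_
        have hpos := (mem_irreducibleMonicsUpTo.mp hP).2.1.natDegree_pos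
        refine Finset.sum_nbij' (fun m => m * P.natDegree) (fun k => k / P.natDegree) ?_ ?_ ?_ ?_ ?_
        · intro m hm
          simp only [Finset.mem_filter, Finset.mem_Icc] at hm ⊢
          exact ⟨⟨Nat.mul_pos hm.1.1 hpos, hm.2⟩, dvd_mul_left _ _⟩
        · intro k hk
          simp only [Finset.mem_filter, Finset.mem_Icc] at hk ⊢
          exact ⟨⟨Nat.div_pos (Nat.le_of_dvd hk.1.1 hk.2) hpos,
            (Nat.div_le_self _ _).trans hk.1.2⟩, (Nat.div_mul_cancel hk.2).trans_le hk.1.2⟩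
        · intro m _
          exact Nat.mul_div_cancel m hpos
        · intro k hk
          exact Nat.div_mul_cancel (Finset.mem_filter.mp hk).2
        · intro m _
          rw [Nat.mul_div_cancel m hpos]
    _ = _ := by
        simp only [Finset.sum_filter, Finset.sum_mul, ite_mul, zero_mul]
        exact Finset.sum_comm

end MonicPolynomials

section ExtensionSums

variable {F L : Type*} [Field F] [Field L] [Algebra F L]

/-- The completely multiplicative function `f ↦ χ(∏ α) θ(∑ α ^ m)` on monic polynomials, where `α`
runs over the roots of `f`. -/
noncomputable def rootsCharacter (χ : MulChar F ℂ) (θ : AddChar F ℂ) (m : ℕ) (f : F[X]) : ℂ :=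
  χ ((-1) ^ f.natDegree * f.coeff 0) * θ (rootPowerSum m f)

section

variable (χ : MulChar F ℂ) (θ : AddChar F ℂ) (m : ℕ)

lemma rootsCharacter_one : rootsCharacter χ θ m 1 = 1 := by
  simp [rootsCharacter]

lemma rootsCharacter_mul (f g : F[X]) (hf : f.Monic) (hg : g.Monic) :
    rootsCharacter χ θ m (f * g) = rootsCharacter χ θ m f * rootsCharacter χ θ m g := by
  rw [rootsCharacter, rootsCharacter, rootsCharacter, rootPowerSum_mul m hf.ne_zero hg.ne_zero,
    hf.natDegree_mul hg, mul_coeff_zero, AddChar.map_add_eq_mul, pow_add, mul_mul_mul_comm, map_mul]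
  ring

end

variable [Fintype F] [Fintype L]

lemma prod_X_sub_C_algEquiv_eq_minpoly_pow (x : L) :
    ∏ σ : Gal(L/F), (X - C (σ x)) =
      ((minpoly F x).map (algebraMap F L)) ^
        (Module.finrank F L / (minpoly F x).natDegree) := by
  classical
  have hxi : IsIntegral F x := .of_finite F x
  have hsplit := Normal.splits (inferInstance : Normal F L) x
  have hsep : (minpoly F x).Separable := Algebra.IsSeparable.isSeparable F x
  set R := ((minpoly F x).aroots L).toFinset
  have hnodup : ((minpoly F x).aroots L).Nodup :=
    nodup_roots hsep.map
  have hR : (minpoly F x).map (algebraMap F L) = ∏ y ∈ R, (X - C y) := by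
    conv_lhs => rw [hsplit.eq_prod_roots_of_monic ((minpoly.monic hxi).map _)]
    rw [Finset.prod, Multiset.toFinset_val, hnodup.dedup]
  have hcardR : R.card = (minpoly F x).natDegree := by
    rw [Multiset.toFinset_card_of_nodup hnodup, aroots_def, ← hsplit.natDegree_eq_card_roots,
      natDegree_map]
  have himage : Finset.univ.image (fun σ : Gal(L/F) => σ x) = R := by
    ext y
    simp only [R, Finset.mem_image, Finset.mem_univ, true_and, Multiset.mem_toFinset]
    rw [← isConjRoot_iff_mem_minpoly_aroots hxi, IsConjRoot.comm, isConjRoot_iff_exists_algEquiv]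
  have hfib : ∀ y ∈ R, (Finset.univ.filter fun σ : Gal(L/F) => σ x = y).card =
      (Finset.univ.filter fun σ : Gal(L/F) => σ x = x).card := by
    intro y hy
    rw [← himage] at hy
    obtain ⟨τ, -, rfl⟩ := Finset.mem_image.mp hy
    refine Finset.card_equiv (Equiv.mulLeft τ⁻¹) fun σ => ?_
    simp only [Finset.mem_filter, Finset.mem_univ, true_and, Equiv.coe_mulLeft, AlgEquiv.mul_apply]
    constructor
    · intro h
      rw [h]
      exact τ.symm_apply_apply x
    · intro h
      exact (τ.apply_symm_apply (σ x)).symm.trans (congrArg τ h)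
  have hcard := Finset.card_eq_sum_card_image (fun σ : Gal(L/F) => σ x) Finset.univ
  rw [himage, Finset.sum_congr rfl hfib, Finset.sum_const, hcardR, Finset.card_univ,
    ← Nat.card_eq_fintype_card, IsGalois.card_aut_eq_finrank, smul_eq_mul] at hcard
  rw [hcard, Nat.mul_div_cancel_left _ (minpoly.natDegree_pos hxi), hR,
    Finset.prod_comp (fun y => X - C y) (fun σ : Gal(L/F) => σ x), himage,
    Finset.prod_congr rfl fun y hy => by rw [hfib y hy], Finset.prod_pow]

section

variable (χ : MulChar F ℂ) (θ : AddChar F ℂ) (m : ℕ)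

lemma rootsCharacter_minpoly_pow (hm : m ≠ 0) (x : L) :
    rootsCharacter χ θ m (minpoly F x) ^ (Module.finrank F L / (minpoly F x).natDegree) =
      χ (Algebra.norm F x) * θ (Algebra.trace F L (x ^ m)) := by
  have hmonic : (minpoly F x).Monic := minpoly.monic (.of_finite F x)
  set e := Module.finrank F L / (minpoly F x).natDegree with he
  have hpow (n : ℕ) : rootsCharacter χ θ m (minpoly F x) ^ n =
      rootsCharacter χ θ m (minpoly F x ^ n) := by
    induction n with
    | zero => simp [rootsCharacter_one]
    | succ n ih => rw [pow_succ, pow_succ, rootsCharacter_mul χ θ m _ _ (hmonic.pow n) hmonic, ih]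
  have hprod := prod_X_sub_C_algEquiv_eq_minpoly_pow (F := F) x
  rw [← he, ← Polynomial.map_pow] at hprod
  have hinj := (algebraMap F L).injective
  rw [hpow, rootsCharacter]
  congr 2
  · apply hinj
    have hd : (minpoly F x ^ e).natDegree = Fintype.card Gal(L/F) := by
      rw [← natDegree_map (algebraMap F L), ← hprod,
        natDegree_prod_of_monic _ _ fun σ _ => monic_X_sub_C _]
      simp
    rw [hd, map_mul, ← coeff_map, ← hprod, coeff_zero_eq_eval_zero, eval_prod,
      Algebra.norm_eq_prod_automorphisms]
    simp [Finset.prod_neg, ← mul_assoc, ← mul_pow]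
  · apply hinj
    rw [← rootPowerSum_map m _ (pow_ne_zero e hmonic.ne_zero), ← hprod,
      rootPowerSum_prod m _ fun σ _ => X_sub_C_ne_zero _, trace_eq_sum_automorphisms]
    simp [rootPowerSum_X_sub_C hm]

lemma card_filter_minpoly_eq [DecidableEq F[X]] {P : F[X]} (hP : P.Monic) (hPi : Irreducible P)
    (hdvd : P.natDegree ∣ Module.finrank F L) :
    (Finset.univ.filter fun x : L => minpoly F x = P).card = P.natDegree := by
  classical
  have : Fact (Irreducible P) := ⟨hPi⟩
  have hfin : Module.finrank F (AdjoinRoot P) = P.natDegree :=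
    finrank_quotient_span_eq_natDegree
  have : Module.Finite F (AdjoinRoot P) := hP.finite_adjoinRoot
  have : Finite (AdjoinRoot P) := Module.finite_of_finite F
  obtain ⟨φ⟩ := FiniteField.nonempty_algHom_of_finrank_dvd (F := F) (K := AdjoinRoot P) (L := L)
    (hfin ▸ hdvd)
  have hx : aeval (φ (AdjoinRoot.root P)) P = 0 := by
    rw [aeval_algHom_apply, AdjoinRoot.aeval_eq, AdjoinRoot.mk_self, map_zero]
  have hmin : minpoly F (φ (AdjoinRoot.root P)) = P :=
    (minpoly.eq_of_irreducible_of_monic hPi hx hP).symm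
  have hsplit := Normal.splits (inferInstance : Normal F L) (φ (AdjoinRoot.root P))
  rw [hmin] at hsplit
  rw [← card_rootSet_eq_natDegree (PerfectField.separable_of_irreducible hPi) hsplit,
    ← Set.toFinset_card]
  congr 1
  ext x
  simp only [Finset.mem_filter, Finset.mem_univ, true_and, Set.mem_toFinset, mem_rootSet]
  constructor
  · rintro rfl
    exact ⟨hP.ne_zero, minpoly.aeval F x⟩
  · rintro ⟨-, h⟩
    exact (minpoly.eq_of_irreducible_of_monic hPi h hP).symm

lemma sum_irreducibleMonicsUpTo (hm : m ≠ 0) {k n : ℕ} (hk : Module.finrank F L = k) (hkn : k ≤ n) :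
    ∑ P ∈ irreducibleMonicsUpTo F n with P.natDegree ∣ k,
        (P.natDegree : ℂ) * rootsCharacter χ θ m P ^ (k / P.natDegree) =
      ∑ x : L, χ (Algebra.norm F x) * θ (Algebra.trace F L (x ^ m)) := by
  classical
  subst hk
  rw [← Finset.sum_fiberwise_of_maps_to (g := fun x : L => minpoly F x)
    (t := (irreducibleMonicsUpTo F n).filter fun P => P.natDegree ∣ Module.finrank F L)]
  · refine Finset.sum_congr rfl fun P hP => ?_
    simp only [Finset.mem_filter, mem_irreducibleMonicsUpTo] at hP
    rw [← card_filter_minpoly_eq (L := L) hP.1.1 hP.1.2.1 hP.2, ← nsmul_eq_mul, ← Finset.sum_const]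
    refine Finset.sum_congr rfl fun x hx => ?_
    obtain ⟨-, rfl⟩ := Finset.mem_filter.mp hx
    rw [← rootsCharacter_minpoly_pow χ θ m hm x,
      card_filter_minpoly_eq (L := L) hP.1.1 hP.1.2.1 hP.2]
  · intro x _
    have hxi : IsIntegral F x := .of_finite F x
    have hdvd := minpoly.degree_dvd hxi
    simp only [Finset.mem_filter, mem_irreducibleMonicsUpTo]
    exact ⟨⟨minpoly.monic hxi, minpoly.irreducible hxi,
      (Nat.le_of_dvd Module.finrank_pos hdvd).trans hkn⟩, hdvd⟩

end

lemma exists_pow_eq_of_norm_pow_eq_one {d t : ℕ} (hdt : d * t = Fintype.card F - 1) {x : L}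
    (hx0 : x ≠ 0) (hx : Algebra.norm F x ^ t = 1) : ∃ y : L, y ^ d = x := by
  set s := ∑ i ∈ Finset.range (Module.finrank F L), Fintype.card F ^ i with hs
  have hcard : Nat.card Lˣ = d * (s * t) := by
    rw [Nat.card_units, Nat.card_eq_fintype_card, Module.card_eq_pow_finrank (K := F) (V := L),
      mul_left_comm, hdt, hs, geom_sum_mul_of_one_le Fintype.card_pos]
  have hpow : x ^ (s * t) = 1 := by
    rw [pow_mul, hs, ← Nat.card_eq_fintype_card, ← FiniteField.algebraMap_norm_eq_pow_sum,
      ← map_pow, hx, map_one]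
  obtain ⟨g, hg⟩ := IsCyclic.exists_monoid_generator (α := Lˣ)
  obtain ⟨a, ha⟩ := Submonoid.mem_powers_iff _ _ |>.mp (hg (Units.mk0 x hx0))
  have hga : g ^ (a * (s * t)) = 1 := by
    rw [pow_mul, ha]
    ext
    simpa using hpow
  have hdvd : d * (s * t) ∣ a * (s * t) := by
    rw [← hcard, ← orderOf_eq_card_of_forall_mem_powers hg]
    exact orderOf_dvd_of_pow_eq_one hga
  have hpos : 0 < s * t := Nat.pos_of_ne_zero fun h => by
    have := Nat.card_pos (α := Lˣ)
    simp [hcard, h] at this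
  obtain ⟨b, rfl⟩ := Nat.dvd_of_mul_dvd_mul_right hpos hdvd
  refine ⟨(g ^ b : Lˣ), ?_⟩
  rw [← Units.val_pow_eq_pow_val, ← pow_mul, mul_comm b d, ha, Units.val_mk0]

lemma card_filter_pow_eq_pow [DecidableEq L] {d : ℕ} (hd : d ∣ Fintype.card L - 1) {z : L}
    (hz : z ≠ 0) : (Finset.univ.filter fun y : L => y ^ d = z ^ d).card = d := by
  obtain ⟨g, hg⟩ := IsCyclic.exists_monoid_generator (α := Lˣ)
  have hcard : orderOf g = Fintype.card L - 1 := by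
    rw [orderOf_eq_card_of_forall_mem_powers hg, Nat.card_units, Nat.card_eq_fintype_card]
  have hpos : 0 < Fintype.card L - 1 := Nat.sub_pos_of_lt Fintype.one_lt_card
  obtain ⟨e, he⟩ := hd
  have hprim : IsPrimitiveRoot ((g ^ e : Lˣ) : L) d := by
    rw [IsPrimitiveRoot.coe_units_iff]
    exact (IsPrimitiveRoot.orderOf g).pow (hcard ▸ hpos) (by rw [hcard, he, mul_comm])
  have hd0 : 0 < d := Nat.pos_of_ne_zero fun h => by simp [he, h] at hpos
  have hroots : (Finset.univ.filter fun y : L => y ^ d = z ^ d) =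
      (nthRoots d (z ^ d)).toFinset := by
    ext y
    simp [mem_nthRoots hd0]
  rw [hroots, Multiset.toFinset_card_of_nodup (hprim.nthRoots_nodup (pow_ne_zero d hz)),
    hprim.card_nthRoots, if_pos ⟨z, rfl⟩]

lemma sum_pow_mulChar_norm {d t : ℕ} (hdt : d * t = Fintype.card F - 1) {ψ : MulChar F ℂ}
    (hψd : ψ ^ d = 1) (hψ : ∀ a : F, ψ a = 1 → a ^ t = 1) {x : L} (hx : x ≠ 0) [DecidableEq L] :
    ∑ i ∈ Finset.range d, ψ (Algebra.norm F x) ^ i =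
      ((Finset.univ.filter fun y : L => y ^ d = x).card : ℂ) := by
  have hpos : 0 < d := Nat.pos_of_ne_zero fun h => by
    have := Nat.sub_pos_of_lt (Fintype.one_lt_card (α := F))
    simp [← hdt, h] at this
  have hψ_pow {a : F} (ha : a ≠ 0) : ψ a ^ d = 1 := by
    rw [← MulChar.pow_apply' _ hpos.ne', hψd, MulChar.one_apply (isUnit_iff_ne_zero.mpr ha)]
  by_cases h : ∃ z : L, z ^ d = x
  · obtain ⟨z, rfl⟩ := h
    have hz : z ≠ 0 := by rintro rfl; simp [hpos.ne'] at hx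
    have hdvd : d ∣ Fintype.card L - 1 := by
      rw [Module.card_eq_pow_finrank (K := F) (V := L)]
      exact (Dvd.intro t hdt).trans (Nat.sub_one_dvd_pow_sub_one ..)
    rw [card_filter_pow_eq_pow hdvd hz]
    simp [map_pow, hψ_pow (Algebra.norm_ne_zero_iff.mpr hz)]
  · rw [Finset.filter_false_of_mem fun y _ hy => h ⟨y, hy⟩, Finset.card_empty, Nat.cast_zero]
    have hne : ψ (Algebra.norm F x) ≠ 1 := fun h1 =>
      h (exists_pow_eq_of_norm_pow_eq_one hdt hx (hψ _ h1))
    rw [geom_sum_eq hne, hψ_pow (Algebra.norm_ne_zero_iff.mpr hx), sub_self, zero_div]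

lemma sum_mulChar_pow_norm {d t : ℕ} (hdt : d * t = Fintype.card F - 1) {ψ : MulChar F ℂ}
    (hψd : ψ ^ d = 1) (hψ : ∀ a : F, ψ a = 1 → a ^ t = 1) (χ : MulChar F ℂ) (θ : AddChar F ℂ) :
    ∑ y : L, (χ ^ d) (Algebra.norm F y) * θ (Algebra.trace F L (y ^ d)) =
      ∑ i ∈ Finset.range d, ∑ x : L, (χ * ψ ^ i) (Algebra.norm F x) *
        θ (Algebra.trace F L (x ^ 1)) := by
  classical
  have hpos : 0 < d := Nat.pos_of_ne_zero fun h => by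
    have := Nat.sub_pos_of_lt (Fintype.one_lt_card (α := F))
    simp [← hdt, h] at this
  rw [Finset.sum_comm, ← Finset.sum_fiberwise Finset.univ (fun y : L => y ^ d)]
  refine Finset.sum_congr rfl fun x _ => ?_
  rcases eq_or_ne x 0 with rfl | hx
  · rw [Finset.sum_eq_zero, Finset.sum_eq_zero]
    · simp [MulChar.map_zero]
    · intro y hy
      have : y = 0 := by simpa [hpos.ne'] using hy
      simp [this, MulChar.map_zero]
  · have hterm (i : ℕ) : (χ * ψ ^ i) (Algebra.norm F x) = χ (Algebra.norm F x) *
        ψ (Algebra.norm F x) ^ i := by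
      have hu : IsUnit (Algebra.norm F x) :=
        isUnit_iff_ne_zero.mpr (Algebra.norm_ne_zero_iff.mpr hx)
      rw [MulChar.mul_apply, ← hu.unit_spec, MulChar.pow_apply_coe]
    simp only [hterm, pow_one]
    rw [← Finset.sum_mul, ← Finset.mul_sum, sum_pow_mulChar_norm hdt hψd hψ hx]
    rw [Finset.sum_congr rfl (g := fun _ => χ (Algebra.norm F x) * θ (Algebra.trace F L x)),
      Finset.sum_const, nsmul_eq_mul]
    · ring
    · intro y hy
      obtain ⟨-, rfl⟩ := Finset.mem_filter.mp hy
      rw [MulChar.pow_apply' _ hpos.ne', ← map_pow, ← map_pow]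

end ExtensionSums

section LSeries

variable {F : Type*} [Field F] [Fintype F] (χ : MulChar F ℂ) (θ : AddChar F ℂ) (m : ℕ)

/-- The `L`-series `∑ f, rootsCharacter χ θ m f * X ^ deg f` over monic polynomials `f`. -/
noncomputable def rootsLSeries : PowerSeries ℂ :=
  .mk fun n => ∑ f ∈ monicsOfDegree F n, rootsCharacter χ θ m f

/-- The logarithmic derivative of `rootsLSeries`. -/
noncomputable def rootsLogDeriv : PowerSeries ℂ :=
  .mk fun k => ∑ P ∈ irreducibleMonicsUpTo F k with P.natDegree ∣ k,
    (P.natDegree : ℂ) * rootsCharacter χ θ m P ^ (k / P.natDegree)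

lemma monicsOfDegree_zero : monicsOfDegree F 0 = {1} := by
  ext f
  rw [mem_monicsOfDegree, Finset.mem_singleton]
  constructor
  · rintro ⟨hf, h⟩
    exact (Monic.natDegree_eq_zero hf).mp h
  · rintro rfl
    exact ⟨monic_one, natDegree_one⟩

lemma irreducibleMonicsUpTo_zero : irreducibleMonicsUpTo F 0 = ∅ := by
  ext f
  simp only [mem_irreducibleMonicsUpTo, Finset.notMem_empty, iff_false]
  rintro ⟨hf, hi, h⟩
  exact hi.natDegree_pos.ne' (Nat.le_zero.mp h)

lemma filter_irreducibleMonicsUpTo {k n : ℕ} (hk : 1 ≤ k) (hkn : k ≤ n) :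
    (irreducibleMonicsUpTo F n).filter (fun P => P.natDegree ∣ k) =
      (irreducibleMonicsUpTo F k).filter (fun P => P.natDegree ∣ k) := by
  ext P
  simp only [Finset.mem_filter, mem_irreducibleMonicsUpTo]
  refine and_congr_left fun h => ?_
  have := Nat.le_of_dvd hk h
  simp [this, this.trans hkn]

lemma constantCoeff_rootsLSeries : (rootsLSeries χ θ m).constantCoeff = 1 := by
  rw [← PowerSeries.coeff_zero_eq_constantCoeff_apply, rootsLSeries, PowerSeries.coeff_mk,
    monicsOfDegree_zero, Finset.sum_singleton, rootsCharacter_one]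

lemma X_mul_derivative_rootsLSeries :
    PowerSeries.X * PowerSeries.derivative ℂ (rootsLSeries χ θ m) =
      rootsLogDeriv χ θ m * rootsLSeries χ θ m := by
  ext n
  have hleft : PowerSeries.coeff n (PowerSeries.X * PowerSeries.derivative ℂ (rootsLSeries χ θ m)) =
      n * PowerSeries.coeff n (rootsLSeries χ θ m) := by
    cases n with
    | zero => simp
    | succ n => rw [PowerSeries.coeff_succ_X_mul, PowerSeries.coeff_derivative]; push_cast; ring
  rw [hleft, PowerSeries.coeff_mul, Finset.Nat.sum_antidiagonal_eq_sum_range_succ_mk,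
    Finset.range_eq_Ico, Finset.sum_eq_sum_Ico_succ_bot n.succ_pos]
  simp only [rootsLSeries, rootsLogDeriv, PowerSeries.coeff_mk]
  rw [irreducibleMonicsUpTo_zero, Finset.filter_empty, Finset.sum_empty, zero_mul, zero_add,
    natCast_mul_sum_monicsOfDegree (rootsCharacter_one χ θ m) (rootsCharacter_mul χ θ m)]
  refine Finset.sum_congr rfl fun k hk => ?_
  obtain ⟨hk1, hkn⟩ := Finset.mem_Icc.mp hk
  rw [filter_irreducibleMonicsUpTo hk1 hkn]

lemma rootsLogDeriv_pow {d t : ℕ} (hdt : d * t = Fintype.card F - 1) {ψ : MulChar F ℂ}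
    (hψd : ψ ^ d = 1) (hψ : ∀ a : F, ψ a = 1 → a ^ t = 1) (χ : MulChar F ℂ) (θ : AddChar F ℂ) :
    rootsLogDeriv (χ ^ d) θ d = ∑ i ∈ Finset.range d, rootsLogDeriv (χ * ψ ^ i) θ 1 := by
  ext k
  rw [map_sum]
  simp only [rootsLogDeriv, PowerSeries.coeff_mk]
  rcases Nat.eq_zero_or_pos k with rfl | hk
  · simp [irreducibleMonicsUpTo_zero]
  have hd : d ≠ 0 := by
    rintro rfl
    have := Nat.sub_pos_of_lt (Fintype.one_lt_card (α := F))
    simp [← hdt] at this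
  obtain ⟨p, hp⟩ := CharP.exists F
  have : Fact p.Prime := ⟨CharP.char_is_prime F p⟩
  have : NeZero k := ⟨hk.ne'⟩
  let L := FiniteField.Extension F p k
  have : Fintype L := Fintype.ofFinite L
  have hL : Module.finrank F L = k := FiniteField.finrank_extension F p k
  rw [sum_irreducibleMonicsUpTo (L := L) _ θ d hd hL le_rfl,
    sum_mulChar_pow_norm hdt hψd hψ χ θ]
  exact Finset.sum_congr rfl fun i _ =>
    (sum_irreducibleMonicsUpTo (L := L) _ θ 1 one_ne_zero hL le_rfl).symm

lemma add_C_mul_X_pow_mem_monicsOfDegree {n k : ℕ} (hk : k < n) {f : F[X]}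
    (hf : f ∈ monicsOfDegree F n) (a : F) : f + C a * X ^ k ∈ monicsOfDegree F n := by
  obtain ⟨hm, rfl⟩ := mem_monicsOfDegree.mp hf
  have hlt : (C a * X ^ k).degree < f.degree :=
    (degree_C_mul_X_pow_le k a).trans_lt
      (by rw [degree_eq_natDegree hm.ne_zero]; exact_mod_cast hk)
  exact mem_monicsOfDegree.mpr
    ⟨hm.add_of_left hlt, natDegree_add_eq_left_of_degree_lt hlt⟩

lemma sum_rootsCharacter_one_one :
    ∑ f ∈ monicsOfDegree F 1, rootsCharacter χ θ 1 f = gaussSum χ θ := by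
  rw [gaussSum]
  refine Finset.sum_nbij' (fun f => -f.coeff 0) (fun a => X - C a) (by simp)
    (fun a _ => mem_monicsOfDegree.mpr ⟨monic_X_sub_C a, natDegree_X_sub_C a⟩) ?_ (by simp) ?_
  · intro f hf
    obtain ⟨hm, h1⟩ := mem_monicsOfDegree.mp hf
    conv_rhs => rw [hm.eq_X_add_C h1]
    simp
  · intro f hf
    obtain ⟨hm, h1⟩ := mem_monicsOfDegree.mp hf
    have : f = X - C (-f.coeff 0) := by
      conv_lhs => rw [hm.eq_X_add_C h1]
      simp
    rw [rootsCharacter, h1]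
    conv_lhs => rw [this, rootPowerSum_X_sub_C one_ne_zero]
    simp

lemma sum_rootsCharacter_one_eq_zero (hθ : θ ≠ 0) {n : ℕ} (hn : 2 ≤ n) :
    ∑ f ∈ monicsOfDegree F n, rootsCharacter χ θ 1 f = 0 := by
  obtain ⟨b, hb⟩ := AddChar.ne_zero_iff.mp hθ
  obtain ⟨n, rfl⟩ := Nat.exists_eq_add_of_le' hn
  have hshift (a : F) {f : F[X]} (hf : f ∈ monicsOfDegree F (n + 2)) :=
    add_C_mul_X_pow_mem_monicsOfDegree (k := n + 1) (by omega) hf a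
  have h : ∑ f ∈ monicsOfDegree F (n + 2), rootsCharacter χ θ 1 f =
      θ b * ∑ f ∈ monicsOfDegree F (n + 2), rootsCharacter χ θ 1 f := by
    rw [Finset.mul_sum]
    refine Finset.sum_nbij' (fun f => f + C b * X ^ (n + 1)) (fun f => f + C (-b) * X ^ (n + 1))
      (fun f hf => hshift b hf) (fun f hf => hshift (-b) hf) (by simp) (by simp) fun f hf => ?_
    obtain ⟨hm, h1⟩ := mem_monicsOfDegree.mp hf
    obtain ⟨-, h2⟩ := mem_monicsOfDegree.mp (hshift b hf)
    rw [rootsCharacter, rootsCharacter, h1, h2,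
      rootPowerSum_add_C_mul_X_pow hm (by omega) one_ne_zero, Nat.cast_one, one_mul,
      mul_left_comm, ← AddChar.map_add_eq_mul, add_sub_cancel]
    simp
  have : (θ b - 1) * ∑ f ∈ monicsOfDegree F (n + 2), rootsCharacter χ θ 1 f = 0 := by
    linear_combination -h
  exact (mul_eq_zero.mp this).resolve_left (sub_ne_zero.mpr hb)

lemma rootsLSeries_one (hθ : θ ≠ 0) :
    rootsLSeries χ θ 1 = 1 + PowerSeries.C (gaussSum χ θ) * PowerSeries.X := by
  ext n
  rw [rootsLSeries, PowerSeries.coeff_mk]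
  match n with
  | 0 => simp [monicsOfDegree_zero, rootsCharacter_one]
  | 1 => simp [sum_rootsCharacter_one_one, PowerSeries.coeff_one]
  | n + 2 =>
    rw [sum_rootsCharacter_one_eq_zero χ θ hθ (by omega)]
    simp [PowerSeries.coeff_one]

lemma prod_gaussSum_eq_sum_rootsCharacter (hθ : θ ≠ 0) {d t : ℕ}
    (hdt : d * t = Fintype.card F - 1) {ψ : MulChar F ℂ}
    (hψd : ψ ^ d = 1) (hψ : ∀ a : F, ψ a = 1 → a ^ t = 1) :
    ∏ i ∈ Finset.range d, gaussSum (χ * ψ ^ i) θ =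
      ∑ f ∈ monicsOfDegree F d, rootsCharacter (χ ^ d) θ d f := by
  have h : ∏ i ∈ Finset.range d, rootsLSeries (χ * ψ ^ i) θ 1 = rootsLSeries (χ ^ d) θ d := by
    refine PowerSeries.eq_of_X_mul_derivative_eq
      (PowerSeries.X_mul_derivative_prod _ fun i _ => X_mul_derivative_rootsLSeries _ θ 1)
      ?_ ?_ (constantCoeff_rootsLSeries ..)
    · rw [← rootsLogDeriv_pow hdt hψd hψ]
      exact X_mul_derivative_rootsLSeries ..
    · rw [map_prod]
      exact Finset.prod_eq_one fun i _ => constantCoeff_rootsLSeries ..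
  simp only [rootsLSeries_one _ θ hθ] at h
  have := PowerSeries.coeff_card_prod_one_add_C_mul_X (Finset.range d)
    fun i => gaussSum (χ * ψ ^ i) θ
  rw [← this, h, Finset.card_range, rootsLSeries, PowerSeries.coeff_mk]

open Classical in
lemma sum_monicsOfDegree_eq_sum_coeff_zero {d : ℕ} (hd : 0 < d) (φ : F[X] → ℂ) :
    ∑ f ∈ monicsOfDegree F d, φ f =
      ∑ f ∈ monicsOfDegree F d with f.coeff 0 = 0, ∑ a : F, φ (f + C a) := by
  rw [← Finset.sum_product']
  have hshift (a : F) {f : F[X]} (hf : f ∈ monicsOfDegree F d) : f + C a ∈ monicsOfDegree F d := by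
    simpa using add_C_mul_X_pow_mem_monicsOfDegree hd hf a
  refine Finset.sum_nbij' (fun f => (f + C (-f.coeff 0), f.coeff 0)) (fun x => x.1 + C x.2)
    ?_ ?_ (by simp) ?_ (by simp)
  · intro f hf
    simp only [Finset.mem_product, Finset.mem_filter, Finset.mem_univ, and_true]
    exact ⟨hshift _ hf, by simp⟩
  · rintro ⟨f, a⟩ hf
    simp only [Finset.mem_product, Finset.mem_filter, Finset.mem_univ, and_true] at hf
    exact hshift _ hf.1
  · rintro ⟨f, a⟩ hf
    simp only [Finset.mem_product, Finset.mem_filter, Finset.mem_univ, and_true] at hf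
    simp [hf.2]

open Classical in
lemma sum_rootsCharacter_pow {d : ℕ} (hd : (d : F) ≠ 0) :
    ∑ f ∈ monicsOfDegree F d, rootsCharacter (χ ^ d) θ d f =
      (∑ f ∈ monicsOfDegree F d with f.coeff 0 = 0, θ (rootPowerSum d f)) *
        ((χ ^ d)⁻¹ d * gaussSum (χ ^ d) θ) := by
  have hd0 : d ≠ 0 := by rintro rfl; simp at hd
  rw [sum_monicsOfDegree_eq_sum_coeff_zero (Nat.pos_of_ne_zero hd0), Finset.sum_mul]
  refine Finset.sum_congr rfl fun f hf => ?_
  rw [Finset.mem_filter] at hf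
  obtain ⟨hm, h1⟩ := mem_monicsOfDegree.mp hf.1
  rw [gaussSum, Finset.mul_sum, Finset.mul_sum]
  refine Fintype.sum_equiv ((Equiv.mulLeft₀ (d : F) hd).trans (Equiv.neg F)) _ _ fun a => ?_
  have h2 : (f + C a).natDegree = d := by rw [natDegree_add_C, h1]
  have h3 := rootPowerSum_add_C_mul_X_pow (n := 0) hm (by omega) hd0 a
  have hsign : (χ ^ d) ((-1) ^ d) = (χ ^ d) (-1) := by
    have : ((-1 : F) ^ d) ^ d = (-1) ^ d := by
      rw [← pow_mul]
      rcases d.even_or_odd with h | h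
      · rw [h.neg_one_pow, (h.mul_left d).neg_one_pow]
      · rw [h.neg_one_pow, (h.mul h).neg_one_pow]
    rw [MulChar.pow_apply' _ hd0, MulChar.pow_apply' _ hd0, ← map_pow, ← map_pow, this]
  have hdd : (χ ^ d)⁻¹ (d : F) * (χ ^ d) d = 1 := by
    rw [← MulChar.mul_apply, inv_mul_cancel, MulChar.one_apply (isUnit_iff_ne_zero.mpr hd)]
  rw [pow_zero, mul_one] at h3
  rw [rootsCharacter, h2, h3, coeff_add, hf.2, coeff_C_zero, zero_add, map_mul, hsign,
    sub_eq_add_neg, AddChar.map_add_eq_mul]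
  change _ = _ * (_ * ((χ ^ d) (-(d * a)) * θ (-(d * a))))
  rw [neg_eq_neg_one_mul (d * a : F), map_mul (χ ^ d), map_mul (χ ^ d)]
  linear_combination -(χ ^ d) (-1) * (χ ^ d) a * θ (rootPowerSum d f) * θ (-1 * (d * a)) * hdd

lemma gaussSum_one (hθ : θ ≠ 0) : gaussSum (1 : MulChar F ℂ) θ = -1 := by
  classical
  have h := AddChar.sum_eq_zero_iff_ne_zero.mpr hθ
  rw [← Finset.add_sum_erase _ _ (Finset.mem_univ 0), AddChar.map_zero_eq_one] at h
  rw [gaussSum, ← Finset.add_sum_erase _ _ (Finset.mem_univ 0), MulChar.map_zero, zero_mul,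
    zero_add, Finset.sum_congr rfl fun x hx => by
      rw [MulChar.one_apply (isUnit_iff_ne_zero.mpr (Finset.ne_of_mem_erase hx)), one_mul]]
  linear_combination h

/-- The **Hasse–Davenport product relation**. -/
theorem prod_gaussSum_mul_pow (hθ : θ ≠ 0) {d t : ℕ} (hdt : d * t = Fintype.card F - 1)
    {ψ : MulChar F ℂ} (hψd : ψ ^ d = 1) (hψ : ∀ a : F, ψ a = 1 → a ^ t = 1) (hd : (d : F) ≠ 0) :
    ∏ i ∈ Finset.range d, gaussSum (χ * ψ ^ i) θ =
      gaussSum (χ ^ d) θ * (χ ^ d)⁻¹ d * ∏ i ∈ Finset.Ico 1 d, gaussSum (ψ ^ i) θ := by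
  have hpos : 0 < d := Nat.pos_of_ne_zero (by rintro rfl; simp at hd)
  have h1 := (prod_gaussSum_eq_sum_rootsCharacter 1 θ hθ hdt hψd hψ).trans
    (sum_rootsCharacter_pow 1 θ hd)
  rw [Finset.range_eq_Ico, Finset.prod_eq_prod_Ico_succ_bot hpos] at h1
  simp only [one_mul, pow_zero, one_pow, inv_one, gaussSum_one θ hθ,
    MulChar.one_apply (isUnit_iff_ne_zero.mpr hd), zero_add] at h1
  rw [prod_gaussSum_eq_sum_rootsCharacter χ θ hθ hdt hψd hψ, sum_rootsCharacter_pow χ θ hd]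
  linear_combination (χ ^ d)⁻¹ d * gaussSum (χ ^ d) θ * h1

end LSeries

end HasseDavenport

lemma pow_eq_one_of_mulChar_pow_apply_eq_one {F : Type*} [Field F] [Fintype F] {T : MulChar F ℂ}
    (hT : ∀ χ : MulChar F ℂ, χ ∈ Subgroup.zpowers T) {t : ℕ} {a : F} (h : (T ^ t) a = 1) :
    a ^ t = 1 := by
  have ha : IsUnit a := by
    by_contra ha
    rw [MulChar.map_nonunit _ ha] at h
    exact zero_ne_one h
  by_contra hne
  obtain ⟨χ, hχ⟩ := MulChar.exists_apply_ne_one_of_hasEnoughRootsOfUnity F ℂ hne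
  obtain ⟨k, rfl⟩ := Subgroup.mem_zpowers_iff.mp (hT χ)
  obtain ⟨u, rfl⟩ := ha
  apply hχ
  rw [← Units.val_pow_eq_pow_val]
  rw [MulChar.pow_apply_coe, ← map_pow, ← Units.val_pow_eq_pow_val] at h
  have hu : T.toUnitHom (u ^ t) = 1 := by
    ext
    simpa using h
  have : (MulChar.mulEquivToUnitHom (T ^ k)) (u ^ t) = 1 := by
    rw [map_zpow, MonoidHom.zpow_apply]
    exact (congrArg (· ^ k) hu).trans (one_zpow k)
  simpa using congrArg Units.val this

/-- The standard additive character as a bundled character. -/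
noncomputable def stdAddCharHom (F : Type*) [Field F] [Fintype F] {p : ℕ} [NeZero p] [CharP F p]
    [Algebra (ZMod p) F] {ζ : ℂ} (hζ : ζ ^ p = 1) : AddChar F ℂ :=
  (AddChar.zmodChar p hζ).compAddMonoidHom (Algebra.trace (ZMod p) F).toAddMonoidHom

lemma gaussSum'_eq_gaussSum {F : Type*} [Field F] [Fintype F] {p : ℕ} [NeZero p] [CharP F p]
    [Algebra (ZMod p) F] {ζ : ℂ} (hζ : ζ ^ p = 1) (χ : MulChar F ℂ) :
    gaussSum' p ζ χ = gaussSum χ (stdAddCharHom F hζ) := rfl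

lemma stdAddCharHom_ne_zero (F : Type*) [Field F] [Fintype F] {p : ℕ} [Fact p.Prime] [CharP F p]
    [Algebra (ZMod p) F] {ζ : ℂ} (hζ : IsPrimitiveRoot ζ p) :
    stdAddCharHom F hζ.pow_eq_one ≠ 0 := by
  have hp : 1 < p := (Fact.out : p.Prime).one_lt
  have : Fact (1 < p) := ⟨hp⟩
  obtain ⟨a, ha⟩ := Algebra.trace_surjective (ZMod p) F 1
  refine AddChar.ne_zero_iff.mpr ⟨a, ?_⟩
  change ζ ^ (Algebra.trace (ZMod p) F a).val ≠ 1
  rw [ha, ZMod.val_one, pow_one]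
  exact hζ.ne_one hp

lemma natCast_ne_zero_of_dvd_card_sub_one {F : Type*} [Field F] [Fintype F] {d : ℕ}
    (hd : d ∣ Fintype.card F - 1) : (d : F) ≠ 0 := by
  intro h
  obtain ⟨t, ht⟩ := hd
  have h1 : ((Fintype.card F - 1 : ℕ) : F) = -1 := by
    rw [Nat.cast_sub Fintype.card_pos, FiniteField.cast_card_eq_zero, Nat.cast_one, zero_sub]
  rw [ht, Nat.cast_mul, h, zero_mul] at h1
  exact one_ne_zero (neg_eq_zero.mp h1.symm)

/-- Hasse–Davenport specialization: for `q ≡ 1 (mod d)`, `t = (q-1)/d` and `T` a generator of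
the character group of `F_q`,
`∏_{i=0}^{d-1} g(T^{it+j}) = g(T^{dj})·T^{-dj}(d)·∏_{i=1}^{d-1} g(T^{it})`. -/
theorem gauss_product_hasse_davenport_general
    (F : Type*) [Field F] [Fintype F] (p : ℕ) [Fact p.Prime] [CharP F p] [Algebra (ZMod p) F]
    (ζ : ℂ) (hζ : IsPrimitiveRoot ζ p)
    (d : ℕ) (hd : 0 < d) (q t : ℕ) (hq : q = Fintype.card F) (hqd : q ≡ 1 [MOD d])
    (ht : t = (q - 1) / d)
    (T : MulChar F ℂ) (hT : ∀ χ : MulChar F ℂ, χ ∈ Subgroup.zpowers T) (j : ℤ) :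
    ∏ i ∈ Finset.range d, gaussSum' p ζ (T ^ ((i : ℤ) * (t : ℤ) + j)) =
      gaussSum' p ζ (T ^ ((d : ℤ) * j)) * (T ^ (-((d : ℤ) * j))) (d : F) *
        ∏ i ∈ Finset.Ico 1 d, gaussSum' p ζ (T ^ (i * t)) := by
  subst hq
  have hdvd : d ∣ Fintype.card F - 1 := (Nat.modEq_iff_dvd' Fintype.card_pos).mp hqd.symm
  have hdt : d * t = Fintype.card F - 1 := by rw [ht, Nat.mul_div_cancel' hdvd]
  have hψd : (T ^ t) ^ d = 1 := by
    classical
    rw [← pow_mul, mul_comm, hdt, ← Fintype.card_units]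
    exact MulChar.pow_card_eq_one T
  have hmain := prod_gaussSum_mul_pow (T ^ j) (stdAddCharHom F hζ.pow_eq_one)
    (stdAddCharHom_ne_zero F hζ) hdt hψd
    (fun a => pow_eq_one_of_mulChar_pow_apply_eq_one hT) (natCast_ne_zero_of_dvd_card_sub_one hdvd)
  simp only [gaussSum'_eq_gaussSum hζ.pow_eq_one]
  have hj : T ^ ((d : ℤ) * j) = (T ^ j) ^ d := by rw [mul_comm, zpow_mul, zpow_natCast]
  rw [zpow_neg, hj]
  refine Eq.trans (Finset.prod_congr rfl fun i _ => ?_) (hmain.trans ?_)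
  · rw [zpow_add, mul_comm, mul_comm (i : ℤ), zpow_mul, zpow_natCast, zpow_natCast]
  · congr 1
    refine Finset.prod_congr rfl fun i _ => ?_
    rw [mul_comm i t, pow_mul]
end

section
/- Let q be a prime power with q ≡ 1 (mod 4), set t = (q−1)/4, and let T be a generator of the group of multiplicative characters of F_q^×. Let N_q(0) denote the number of points in P³(F_q) on the Fermat quartic surface x₁⁴ + x₂⁴ + x₃⁴ + x₄⁴ = 0. Then N_q(0) = q² + 7q + 1 + (1/q)·Σ_{i=1}^{3} g(T^{it})⁴ + 12q·T^t(−1). -/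
/-- The number of points of the Fermat quartic surface `x₁⁴+x₂⁴+x₃⁴+x₄⁴ = 0` in `ℙ³(F)`. -/
noncomputable def fermatQuarticCount (F : Type*) [Field F] [Fintype F] : ℕ :=
  Nat.card {P : Projectivization F (Fin 4 → F) //
    P.rep 0 ^ 4 + P.rep 1 ^ 4 + P.rep 2 ^ 4 + P.rep 3 ^ 4 = 0}

/-- The standard additive character of a finite field is primitive. -/
lemma isPrimitive_zmodChar_comp_trace (F : Type*) [Field F] [Fintype F] (p : ℕ) [Fact p.Prime]
    [Algebra (ZMod p) F] {ζ : ℂ} (hζ : IsPrimitiveRoot ζ p) :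
    ((AddChar.zmodChar p hζ.pow_eq_one).compAddMonoidHom
      (Algebra.trace (ZMod p) F).toAddMonoidHom).IsPrimitive := by
  apply AddChar.IsPrimitive.of_ne_one
  obtain ⟨x, hx⟩ := Algebra.trace_surjective (ZMod p) F 1
  refine AddChar.ne_one_iff.2 ⟨x, ?_⟩
  have : Fact (1 < p) := ⟨(Fact.out : p.Prime).one_lt⟩
  have h : (AddChar.zmodChar p hζ.pow_eq_one).compAddMonoidHom
      (Algebra.trace (ZMod p) F).toAddMonoidHom x = ζ := by
    simp [AddChar.zmodChar_apply, hx, ZMod.val_one]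
  rw [h]
  exact hζ.ne_one (Fact.out : p.Prime).one_lt

/-- A generator of the group of complex characters of `Fˣ` has order `#F - 1`. -/
lemma MulChar.orderOf_eq_card_sub_one_of_generates {F : Type*} [Field F] [Fintype F]
    {T : MulChar F ℂ} (hT : ∀ χ : MulChar F ℂ, χ ∈ Subgroup.zpowers T) :
    orderOf T = Fintype.card F - 1 := by
  classical
  rw [orderOf_eq_card_of_forall_mem_zpowers hT]
  have : NeZero (Monoid.exponent Fˣ : ℂ) :=
    ⟨Nat.cast_ne_zero.2 (Monoid.exponent_ne_zero_of_finite)⟩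
  rw [MulChar.card_eq_card_units_of_hasEnoughRootsOfUnity F ℂ, Nat.card_eq_fintype_card,
    Fintype.card_units]

/-- The number of solutions of `x ^ n = u`, in terms of a character `χ` of order `n`. -/
lemma card_filter_pow_eq {F : Type*} [Field F] [Fintype F] [DecidableEq F] {n : ℕ} (hn : n ≠ 0)
    {χ : MulChar F ℂ} (hχ : orderOf χ = n) (u : F) :
    ((Finset.univ.filter fun x : F ↦ x ^ n = u).card : ℂ) =
      1 + ∑ i ∈ Finset.Icc 1 (n - 1), χ u ^ i := by
  have hIcc : 1 + ∑ i ∈ Finset.Icc 1 (n - 1), χ u ^ i = ∑ i ∈ Finset.range n, χ u ^ i := by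
    obtain ⟨m, rfl⟩ := Nat.exists_eq_succ_of_ne_zero hn
    rw [Finset.sum_range_succ', pow_zero, add_comm, Finset.range_eq_Ico,
      Finset.sum_Ico_add' (fun i ↦ χ u ^ i) 0 m 1]
    rfl
  rw [hIcc]
  have hdvd : n ∣ Fintype.card F - 1 := hχ ▸ χ.orderOf_dvd_card_sub_one
  obtain ⟨g, hg⟩ := IsCyclic.exists_generator (α := Fˣ)
  have hgord : orderOf g = Fintype.card F - 1 := by
    rw [orderOf_eq_card_of_forall_mem_zpowers hg, Nat.card_eq_fintype_card, Fintype.card_units]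
  have hχg : IsPrimitiveRoot (χ g) n := by
    refine ⟨?_, fun k hk ↦ ?_⟩
    · rw [← MulChar.pow_apply_coe, ← hχ, pow_orderOf_eq_one, MulChar.one_apply_coe]
    · rw [← hχ]
      apply orderOf_dvd_of_pow_eq_one
      rw [MulChar.eq_iff hg, MulChar.pow_apply_coe, hk, MulChar.one_apply_coe]
  obtain ⟨m, hm⟩ := hdvd
  have hroot : IsPrimitiveRoot ((g : F) ^ m) n := by
    have h := (IsPrimitiveRoot.orderOf g).pow (orderOf_pos g)
      (show orderOf g = m * n by rw [hgord, hm, mul_comm])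
    simpa using h.map_of_injective (f := Units.coeHom F) Units.val_injective
  rcases eq_or_ne u 0 with rfl | hu
  · have : (Finset.univ.filter fun x : F ↦ x ^ n = 0) = {0} := by
      ext x; simp [hn]
    rw [this, MulChar.map_zero, zero_geom_sum, if_neg hn, Finset.card_singleton, Nat.cast_one]
  have hcard : (Finset.univ.filter fun x : F ↦ x ^ n = u).card =
      if ∃ a : F, a ^ n = u then n else 0 := by
    trans (Polynomial.nthRoots n u).card
    swap
    · convert hroot.card_nthRoots u
    rw [← Multiset.toFinset_card_of_nodup (hroot.nthRoots_nodup hu)]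
    congr 1
    ext x
    simp [Polynomial.mem_nthRoots (Nat.pos_of_ne_zero hn)]
  have hpow : χ u ^ n = 1 := by
    rw [← MulChar.pow_apply' _ hn, ← hχ, pow_orderOf_eq_one, MulChar.one_apply hu.isUnit]
  have hiff : (∃ a : F, a ^ n = u) ↔ χ u = 1 := by
    constructor
    · rintro ⟨a, rfl⟩
      have ha : a ≠ 0 := by
        rintro rfl
        simp [hn] at hu
      rw [map_pow, ← MulChar.pow_apply' _ hn, ← hχ, pow_orderOf_eq_one,
        MulChar.one_apply ha.isUnit]
    · intro h
      obtain ⟨k, hk⟩ := mem_powers_iff_mem_zpowers.2 (hg (Units.mk0 u hu))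
      have hk' : (g : F) ^ k = u := by simpa using congrArg Units.val hk
      rw [← hk', map_pow] at h
      obtain ⟨j, rfl⟩ := hχg.dvd_of_pow_eq_one k h
      exact ⟨(g : F) ^ j, by rw [← hk', ← pow_mul, mul_comm]⟩
  rw [hcard]
  by_cases h : χ u = 1
  · simp [hiff.2 h, h]
  · rw [if_neg (mt hiff.1 h), Nat.cast_zero, geom_sum_eq h, hpow, sub_self, zero_div]

/-- The exponential sum of `x ↦ x ^ n` is a combination of Gauss sums. -/
lemma sum_addChar_mul_pow {F : Type*} [Field F] [Fintype F] {n : ℕ} (hn : n ≠ 0)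
    {χ : MulChar F ℂ} (hχ : orderOf χ = n) {ψ : AddChar F ℂ} (hψ : ψ.IsPrimitive)
    {y : F} (hy : y ≠ 0) :
    ∑ x, ψ (y * x ^ n) = ∑ i ∈ Finset.Icc 1 (n - 1), (χ⁻¹ y) ^ i * gaussSum (χ ^ i) ψ := by
  classical
  have hfib : ∑ x, ψ (y * x ^ n) =
      ∑ u, ((Finset.univ.filter fun x : F ↦ x ^ n = u).card : ℂ) * ψ (y * u) := by
    rw [← Finset.sum_fiberwise Finset.univ (fun x : F ↦ x ^ n)]
    refine Finset.sum_congr rfl fun u _ ↦ ?_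
    rw [Finset.sum_congr rfl (g := fun _ ↦ ψ (y * u)) (by simp +contextual), Finset.sum_const,
      nsmul_eq_mul]
  have hzero : ∑ u, ψ (y * u) = 0 := by
    have := AddChar.sum_mulShift y hψ
    simpa [mul_comm, hy] using this
  simp_rw [hfib, card_filter_pow_eq hn hχ, add_mul, one_mul, Finset.sum_add_distrib, hzero,
    zero_add, Finset.sum_mul]
  rw [Finset.sum_comm]
  refine Finset.sum_congr rfl fun i hi ↦ ?_
  have hi0 : i ≠ 0 := by
    have := (Finset.mem_Icc.1 hi).1
    omega
  have h := gaussSum_mulShift_eq (χ ^ i) ψ (Units.mk0 y hy)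
  simp only [Units.val_mk0, gaussSum, AddChar.mulShift_apply] at h
  rw [← MulChar.pow_apply' _ hi0, inv_pow]
  simpa [gaussSum, MulChar.pow_apply' _ hi0] using h

/-- The number of nonzero solutions of a homogeneous condition is the number of projective
solutions times the number of nonzero scalars. -/
lemma card_ne_zero_and_eq_card_projectivization_mul {F V : Type*} [Field F] [Fintype F]
    [AddCommGroup V] [Module F V] [Finite V] (P : V → Prop)
    (hP : ∀ (a : F) (v : V), a ≠ 0 → (P (a • v) ↔ P v)) :
    Nat.card {v : V // v ≠ 0 ∧ P v} =
      Nat.card {x : Projectivization F V // P x.rep} * (Fintype.card F - 1) := by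
  classical
  have e : {v : V // v ≠ 0 ∧ P v} ≃ {x : Projectivization F V // P x.rep} × Fˣ := by
    refine (Equiv.ofBijective
      (fun z : {x : Projectivization F V // P x.rep} × Fˣ ↦
        (⟨(z.2 : F) • z.1.1.rep, smul_ne_zero z.2.ne_zero z.1.1.rep_nonzero,
          (hP _ _ z.2.ne_zero).2 z.1.2⟩ : {v : V // v ≠ 0 ∧ P v})) ⟨?_, ?_⟩).symm
    · rintro ⟨⟨x, hx⟩, a⟩ ⟨⟨y, hy⟩, b⟩ h
      have h : (a : F) • x.rep = (b : F) • y.rep := congrArg Subtype.val h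
      have hxy : x = y := by
        rw [← x.mk_rep, ← y.mk_rep, Projectivization.mk_eq_mk_iff]
        exact ⟨a⁻¹ * b, by rw [mul_smul, Units.smul_def b, ← h, ← Units.smul_def, inv_smul_smul]⟩
      subst hxy
      have : (a : F) = b := smul_left_injective F x.rep_nonzero h
      simpa using Units.ext this
    · rintro ⟨v, hv, hPv⟩
      obtain ⟨a, ha⟩ := Projectivization.exists_smul_eq_mk_rep F v hv
      refine ⟨⟨⟨Projectivization.mk F v hv, ?_⟩, a⁻¹⟩, ?_⟩
      · rw [← ha]
        exact (hP _ _ a.ne_zero).2 hPv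
      · apply Subtype.ext
        change ((a⁻¹ : Fˣ) : F) • (Projectivization.mk F v hv).rep = v
        rw [← ha, ← Units.smul_def, inv_smul_smul]
  rw [Nat.card_congr e, Nat.card_prod, Nat.card_eq_fintype_card (α := Fˣ), Fintype.card_units]

/-- An additive character turns finite sums into finite products. -/
lemma AddChar.map_sum_eq_prod {A M ι : Type*} [AddCommMonoid A] [CommMonoid M] (ψ : AddChar A M)
    (s : Finset ι) (f : ι → A) : ψ (∑ i ∈ s, f i) = ∏ i ∈ s, ψ (f i) := by
  classical
  induction s using Finset.induction_on with
  | empty => simp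
  | insert a s ha ih => rw [Finset.sum_insert ha, Finset.prod_insert ha, map_add_eq_mul, ih]

/-- Counting the zeros of a diagonal equation by additive characters. -/
lemma card_mul_card_sum_pow_eq_zero {F ι : Type*} [Field F] [Fintype F] [Fintype ι]
    [DecidableEq F] [DecidableEq ι] (n : ℕ) {ψ : AddChar F ℂ} (hψ : ψ.IsPrimitive) :
    (Fintype.card F : ℂ) * (Finset.univ.filter fun v : ι → F ↦ ∑ i, v i ^ n = 0).card =
      ∑ y, (∑ x, ψ (y * x ^ n)) ^ Fintype.card ι := by
  have h (y : F) : (∑ x, ψ (y * x ^ n)) ^ Fintype.card ι =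
      ∑ v : ι → F, ψ (y * ∑ i, v i ^ n) := by
    simp_rw [Finset.mul_sum, AddChar.map_sum_eq_prod]
    rw [← Finset.card_univ, ← Finset.prod_const, Finset.prod_univ_sum]
    simp
  simp_rw [h]
  rw [Finset.sum_comm]
  simp_rw [AddChar.sum_mulShift _ hψ]
  rw [← Nat.cast_sum, Finset.sum_ite]
  push_cast
  simp [mul_comm]

/-- The fourth moment of the exponential sums of `x ↦ x ^ 4`. -/
lemma sum_sum_addChar_mul_pow_four_pow_four {F : Type*} [Field F] [Fintype F]
    {χ : MulChar F ℂ} (hχ : orderOf χ = 4) {ψ : AddChar F ℂ} (hψ : ψ.IsPrimitive) :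
    ∑ y, (∑ x, ψ (y * x ^ 4)) ^ 4 = (Fintype.card F : ℂ) ^ 4 +
      ((Fintype.card F : ℂ) - 1) * (∑ i ∈ Finset.Icc 1 3, gaussSum (χ ^ i) ψ ^ 4 +
        6 * (Fintype.card F : ℂ) ^ 2 + 12 * χ (-1) * (Fintype.card F : ℂ) ^ 2) := by
  classical
  have hpow4 : χ ^ 4 = 1 := hχ ▸ pow_orderOf_eq_one χ
  have hne (i : ℕ) (h0 : i ≠ 0) (h4 : i < 4) : χ ^ i ≠ 1 := fun h ↦ by
    have := Nat.le_of_dvd (Nat.pos_of_ne_zero h0) (orderOf_dvd_of_pow_eq_one h)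
    omega
  have hprod (φ : MulChar F ℂ) (hφ : φ ≠ 1) :
      gaussSum φ ψ * gaussSum φ⁻¹ ψ = φ (-1) * Fintype.card F := by
    rw [← gaussSum_mul_gaussSum_eq_card hφ hψ, ← mul_gaussSum_inv_eq_gaussSum φ⁻¹ ψ,
      MulChar.inv_apply', inv_neg_one]
    ring
  have hinv3 : χ⁻¹ = χ ^ 3 := inv_eq_of_mul_eq_one_right (by rw [← pow_succ', hpow4])
  have hinv2 : (χ ^ 2)⁻¹ = χ ^ 2 := inv_eq_of_mul_eq_one_right (by rw [← pow_add, hpow4])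
  have h13 := hprod χ (by simpa using hne 1 (by norm_num) (by norm_num))
  have h22 := hprod (χ ^ 2) (hne 2 (by norm_num) (by norm_num))
  rw [hinv3] at h13
  rw [hinv2, MulChar.pow_apply' _ two_ne_zero, ← map_pow, neg_one_sq, map_one, one_mul] at h22
  have hχneg : χ (-1) ^ 2 = 1 := by rw [← map_pow, neg_one_sq, map_one]
  set q : ℂ := (Fintype.card F : ℂ) with hq
  set a := gaussSum χ ψ with ha
  set b := gaussSum (χ ^ 2) ψ with hb
  set c := gaussSum (χ ^ 3) ψ with hc
  have hS (y : F) (hy : y ≠ 0) : (∑ x, ψ (y * x ^ 4)) ^ 4 =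
      (a ^ 4 + b ^ 4 + c ^ 4 + 12 * a * b ^ 2 * c + 6 * a ^ 2 * c ^ 2) +
      (4 * a ^ 3 * b + 4 * b ^ 3 * c + 12 * a * b * c ^ 2) * χ⁻¹ y +
      (6 * a ^ 2 * b ^ 2 + 4 * a ^ 3 * c + 6 * b ^ 2 * c ^ 2 + 4 * a * c ^ 3) * χ⁻¹ y ^ 2 +
      (4 * a * b ^ 3 + 12 * a ^ 2 * b * c + 4 * b * c ^ 3) * χ⁻¹ y ^ 3 := by
    have hw : χ⁻¹ y ^ 4 = 1 := by
      rw [← MulChar.pow_apply' _ four_ne_zero, inv_pow, hpow4, inv_one,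
        MulChar.one_apply hy.isUnit]
    rw [sum_addChar_mul_pow four_ne_zero hχ hψ hy, show Finset.Icc 1 (4 - 1) = {1, 2, 3} from rfl]
    simp only [Finset.sum_insert, Finset.mem_insert, Finset.mem_singleton, Finset.sum_singleton,
      pow_one, OfNat.one_ne_ofNat, or_self, not_false_eq_true, Nat.reduceEqDiff]
    rw [← ha, ← hb, ← hc]
    generalize χ⁻¹ y = w at hw ⊢
    linear_combination (a ^ 4 + 4 * a ^ 3 * b * w + (6 * a ^ 2 * b ^ 2 + 4 * a ^ 3 * c) * w ^ 2 +
      (4 * a * b ^ 3 + 12 * a ^ 2 * b * c) * w ^ 3 +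
      (w ^ 4 + 1) * (b ^ 4 + 12 * a * b ^ 2 * c + 6 * a ^ 2 * c ^ 2 +
        (4 * b ^ 3 * c + 12 * a * b * c ^ 2) * w + (6 * b ^ 2 * c ^ 2 + 4 * a * c ^ 3) * w ^ 2 +
        4 * b * c ^ 3 * w ^ 3) + (w ^ 8 + w ^ 4 + 1) * c ^ 4) * hw
  have hsum (i : ℕ) (h0 : i ≠ 0) (h4 : i < 4) : ∑ y ∈ {0}ᶜ, χ⁻¹ y ^ i = 0 := by
    have h := MulChar.sum_eq_zero_of_ne_one (inv_ne_one.2 (hne i h0 h4))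
    simp only [← inv_pow, MulChar.pow_apply' _ h0] at h
    rwa [← Finset.sum_compl_add_sum {0}, Finset.sum_singleton, MulChar.map_zero, zero_pow h0,
      add_zero] at h
  have hcard : ((({0}ᶜ : Finset F).card : ℕ) : ℂ) = q - 1 := by
    rw [Finset.card_compl, Finset.card_singleton, Nat.cast_sub Fintype.card_pos, Nat.cast_one]
  have h1 := hsum 1 (by norm_num) (by norm_num)
  simp only [pow_one] at h1
  rw [← Finset.sum_compl_add_sum {0}, Finset.sum_congr rfl fun y hy ↦ hS y (by simpa using hy)]
  simp only [Finset.sum_add_distrib, ← Finset.mul_sum, hsum 3 (by norm_num) (by norm_num),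
    hsum 2 (by norm_num) (by norm_num), h1, Finset.sum_const, nsmul_eq_mul, hcard,
    Finset.sum_singleton, zero_mul, AddChar.map_zero_eq_one, mul_one, mul_zero, add_zero,
    Finset.card_univ, ← hq]
  have hI : ∑ i ∈ Finset.Icc 1 3, gaussSum (χ ^ i) ψ ^ 4 = a ^ 4 + b ^ 4 + c ^ 4 := by
    rw [show Finset.Icc 1 3 = {1, 2, 3} from rfl]
    simp [ha, hb, hc, add_assoc]
  rw [hI]
  linear_combination (q - 1) * (12 * a * c * h22 + 12 * q * h13 +
    6 * (a * c + χ (-1) * q) * h13 + 6 * q ^ 2 * hχneg)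

/-- Proposition 4.2: for `q ≡ 1 (mod 4)`, `t = (q-1)/4`, `T` a generator of the character group
of `F_q^×`: the number `N_q(0)` of projective points on the Fermat quartic satisfies
`N_q(0) = q² + 7q + 1 + (1/q)·∑_{i=1}^{3} g(T^{it})⁴ + 12q·T^t(-1)`. -/
theorem fermat_quartic_point_count
    (F : Type*) [Field F] [Fintype F] (p : ℕ) [Fact p.Prime] [CharP F p] [Algebra (ZMod p) F]
    (ζ : ℂ) (hζ : IsPrimitiveRoot ζ p)
    (q t : ℕ) (hq : q = Fintype.card F) (hq4 : q % 4 = 1) (ht : t = (q - 1) / 4)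
    (T : MulChar F ℂ) (hT : ∀ χ : MulChar F ℂ, χ ∈ Subgroup.zpowers T) :
    (fermatQuarticCount F : ℂ) =
      (q : ℂ) ^ 2 + 7 * (q : ℂ) + 1 +
        (1 / (q : ℂ)) * ∑ i ∈ Finset.Icc 1 3, gaussSum' p ζ (T ^ (i * t)) ^ 4 +
        12 * (q : ℂ) * (T ^ t) (-1 : F) := by
  classical
  subst hq
  have h4 : orderOf (T ^ t) = 4 := by
    have hord := MulChar.orderOf_eq_card_sub_one_of_generates hT
    have h1 := Fintype.one_lt_card (α := F)
    have hmul : orderOf T = t * 4 := by omega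
    have ht0 : t ≠ 0 := by omega
    rw [orderOf_pow_of_dvd ht0 (hmul ▸ dvd_mul_right t 4), hmul,
      Nat.mul_div_cancel_left 4 (Nat.pos_of_ne_zero ht0)]
  have hψ := isPrimitive_zmodChar_comp_trace F p hζ
  set ψ := (AddChar.zmodChar p hζ.pow_eq_one).compAddMonoidHom
    (Algebra.trace (ZMod p) F).toAddMonoidHom
  have hg (i : ℕ) : gaussSum' p ζ (T ^ (i * t)) = gaussSum ((T ^ t) ^ i) ψ := by
    rw [← pow_mul, mul_comm]
    rfl
  simp_rw [hg]
  have hA := card_mul_card_sum_pow_eq_zero (ι := Fin 4) 4 hψ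
  rw [Fintype.card_fin, sum_sum_addChar_mul_pow_four_pow_four h4 hψ] at hA
  have hN := card_ne_zero_and_eq_card_projectivization_mul (F := F) (V := Fin 4 → F)
    (fun v ↦ v 0 ^ 4 + v 1 ^ 4 + v 2 ^ 4 + v 3 ^ 4 = 0) (fun a v ha ↦ by
      simp [mul_pow, ← mul_add, ha])
  have hAN : (Finset.univ.filter fun v : Fin 4 → F ↦ ∑ i, v i ^ 4 = 0).card =
      fermatQuarticCount F * (Fintype.card F - 1) + 1 := by
    rw [fermatQuarticCount, ← hN, Nat.card_eq_fintype_card, Fintype.card_subtype,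
      ← Finset.card_erase_add_one (a := 0) (by simp)]
    congr 2
    ext v
    simp [Fin.sum_univ_four]
  have hq0 : (Fintype.card F : ℂ) ≠ 0 := Nat.cast_ne_zero.2 Fintype.card_ne_zero
  have hq1 : (Fintype.card F : ℂ) - 1 ≠ 0 :=
    sub_ne_zero.2 (by exact_mod_cast (Fintype.one_lt_card (α := F)).ne')
  rw [hAN, Nat.cast_add, Nat.cast_mul, Nat.cast_sub Fintype.card_pos, Nat.cast_one] at hA
  apply mul_left_cancel₀ (mul_ne_zero hq0 hq1)
  linear_combination hA - ((Fintype.card F : ℂ) - 1) *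
    (∑ i ∈ Finset.Icc 1 3, gaussSum ((T ^ t) ^ i) ψ ^ 4) * one_div_mul_cancel hq0
end

section
/- Let q be a prime power with q ≡ 1 (mod 4), set t = (q−1)/4, let T be a generator of the group of multiplicative characters of F_q^×, ε the trivial character, and let λ ∈ F_q^×. Define S₀ := (1/(q−1))·Σ_{j=0}^{q−2} (g(T^j)⁴ / g(T^{4j}))·T^{4j}(4λ). Then S₀ = −(1/q)·Σ_{i=1}^{3} g(T^{it})⁴ + q² · ₃F₂(T^t, T^{2t}, T^{3t}; ε, ε | 1/λ⁴)_q. -/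
/-- Greene's normalized Jacobi sum `binom(A,B) = B(-1)/q · ∑ₓ A(x) B̄(1-x)`. -/
noncomputable def jacB {F : Type*} [Field F] [Fintype F] (A B : MulChar F ℂ) : ℂ :=
  B (-1) / (Fintype.card F : ℂ) * ∑ x : F, A x * B⁻¹ (1 - x)

/-- Greene's finite field hypergeometric function `₂F₁(A, B; C | x)`. -/
noncomputable def greene2F1 {F : Type*} [Field F] [Fintype F]
    (A B C : MulChar F ℂ) (x : F) : ℂ :=
  (Fintype.card F : ℂ) / ((Fintype.card F : ℂ) - 1) *
    ∑ᶠ χ : MulChar F ℂ, jacB (A * χ) χ * jacB (B * χ) (C * χ) * χ x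

/-- Greene's finite field hypergeometric function `₃F₂(A₀, A₁, A₂; B₁, B₂ | x)`. -/
noncomputable def greene3F2 {F : Type*} [Field F] [Fintype F]
    (A₀ A₁ A₂ B₁ B₂ : MulChar F ℂ) (x : F) : ℂ :=
  (Fintype.card F : ℂ) / ((Fintype.card F : ℂ) - 1) *
    ∑ᶠ χ : MulChar F ℂ,
      jacB (A₀ * χ) χ * jacB (A₁ * χ) (B₁ * χ) * jacB (A₂ * χ) (B₂ * χ) * χ x

theorem ne_one_of_isPrimitive {F : Type*} [Field F] {ψ : AddChar F ℂ} (hψ : ψ.IsPrimitive) :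
    ψ ≠ 1 := by
  simpa only [AddChar.mulShift_one] using hψ one_ne_zero

theorem apply_neg_one_sq {F : Type*} [Field F] (χ : MulChar F ℂ) : χ (-1) ^ 2 = 1 := by
  rw [← map_pow, neg_one_sq, map_one]

section HasseDavenport

variable {F : Type*} [Field F] [Fintype F]

/-- A complex character of order two is the quadratic character. -/
theorem MulChar.eq_quadraticChar_ringHomComp [DecidableEq F] (hF : ringChar F ≠ 2)
    {φ : MulChar F ℂ} (h1 : φ ≠ 1) (h2 : φ ^ 2 = 1) :
    φ = (quadraticChar F).ringHomComp (Int.castRingHom ℂ) := by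
  obtain ⟨g, hg⟩ := IsCyclic.exists_generator (α := Fˣ)
  have key : ∀ η : MulChar F ℂ, η ≠ 1 → η ^ 2 = 1 → η g = -1 := by
    intro η h1 h2
    have hs : η g ^ 2 = 1 := by
      rw [← MulChar.pow_apply_coe, h2, MulChar.one_apply_coe]
    rw [Ne, MulChar.eq_iff hg, MulChar.one_apply_coe] at h1
    exact (sq_eq_sq_iff_eq_or_eq_neg.mp (hs.trans (one_pow 2).symm)).resolve_left h1
  rw [MulChar.eq_iff hg, key φ h1 h2, key]
  · exact (MulChar.ringHomComp_ne_one_iff (RingHom.injective_int _)).mpr (quadraticChar_ne_one hF)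
  · exact MulChar.isQuadratic_iff_sq_eq_one.mp ((quadraticChar_isQuadratic F).comp _)

theorem sum_comp_sq (hF : ringChar F ≠ 2) {φ : MulChar F ℂ} (h1 : φ ≠ 1) (h2 : φ ^ 2 = 1)
    (f : F → ℂ) : ∑ y, f (y ^ 2) = ∑ u, f u + ∑ u, φ u * f u := by
  classical
  rw [← Finset.sum_add_distrib, ← Finset.sum_fiberwise' _ (fun y : F => y ^ 2)]
  refine Finset.sum_congr rfl fun u _ => ?_
  have h := congrArg (Int.cast : ℤ → ℂ) (quadraticChar_card_sqrts hF u)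
  have hc : {x : F | x ^ 2 = u}.toFinset = Finset.univ.filter fun x => x ^ 2 = u := by
    ext; simp
  rw [hc] at h
  rw [MulChar.eq_quadraticChar_ringHomComp hF h1 h2, Finset.sum_const, nsmul_eq_mul]
  push_cast at h
  rw [h, MulChar.ringHomComp_apply, eq_intCast]
  ring

/-- The duplication formula for Jacobi sums. -/
theorem apply_four_mul_jacobiSum_self (hF : ringChar F ≠ 2) {φ χ : MulChar F ℂ} (h1 : φ ≠ 1)
    (h2 : φ ^ 2 = 1) (hχ : χ ≠ 1) : χ 4 * jacobiSum χ χ = jacobiSum χ φ := by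
  have h20 : (2 : F) ≠ 0 := Ring.two_ne_zero hF
  have hbij : Function.Bijective fun y : F => (1 + y) * 2⁻¹ :=
    (mulRight_bijective₀ _ (inv_ne_zero h20)).comp (AddGroup.addLeft_bijective 1)
  have h0 : ∑ u, χ (1 - u) = 0 := by
    rw [← MulChar.sum_eq_zero_of_ne_one hχ]
    exact (Equiv.subLeft (1 : F)).sum_comp χ
  calc χ 4 * jacobiSum χ χ = χ 4 * ∑ y : F, χ ((1 + y) * 2⁻¹) * χ (1 - (1 + y) * 2⁻¹) := by
        rw [jacobiSum, hbij.sum_comp fun x => χ x * χ (1 - x)]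
    _ = ∑ y : F, χ (1 - y ^ 2) := by
        rw [Finset.mul_sum]
        refine Finset.sum_congr rfl fun y _ => ?_
        rw [← map_mul, ← map_mul]
        congr 1
        field_simp
        ring
    _ = jacobiSum χ φ := by
        rw [sum_comp_sq hF h1 h2 fun u => χ (1 - u), h0, zero_add, jacobiSum_comm, jacobiSum]

theorem gaussSum_ne_zero {ψ : AddChar F ℂ} (hψ : ψ.IsPrimitive) (χ : MulChar F ℂ) :
    gaussSum χ ψ ≠ 0 := by
  by_cases h : χ = 1
  · rw [h, gaussSum_one_left (ne_one_of_isPrimitive hψ)]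
    exact neg_ne_zero.mpr one_ne_zero
  · exact gaussSum_ne_zero_of_nontrivial (Nat.cast_ne_zero.mpr Fintype.card_ne_zero) h hψ

theorem gaussSum_mul_gaussSum_inv [DecidableEq (MulChar F ℂ)] {ψ : AddChar F ℂ}
    (hψ : ψ.IsPrimitive) (χ : MulChar F ℂ) :
    gaussSum χ ψ * gaussSum χ⁻¹ ψ = χ (-1) * if χ = 1 then 1 else (Fintype.card F : ℂ) := by
  split_ifs with h
  · rw [h, inv_one, gaussSum_one_left (ne_one_of_isPrimitive hψ), MulChar.one_apply isUnit_one.neg]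
    norm_num
  · have h3 : χ⁻¹ (-1) = χ (-1) := by rw [MulChar.inv_apply', inv_neg, inv_one]
    rw [← gaussSum_mul_gaussSum_eq_card h hψ, ← mul_gaussSum_inv_eq_gaussSum χ⁻¹, h3]
    ring

/-- The Hasse–Davenport product formula for characters of order two. -/
theorem apply_four_mul_gaussSum_mul (hF : ringChar F ≠ 2) {ψ : AddChar F ℂ} (hψ : ψ.IsPrimitive)
    {φ : MulChar F ℂ} (h1 : φ ≠ 1) (h2 : φ ^ 2 = 1) (χ : MulChar F ℂ) :
    χ 4 * (gaussSum χ ψ * gaussSum (χ * φ) ψ) = gaussSum (χ ^ 2) ψ * gaussSum φ ψ := by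
  have h20 : (2 : F) ≠ 0 := Ring.two_ne_zero hF
  have h4 : (4 : F) = 2 ^ 2 := by norm_num
  by_cases hχ : χ = 1
  · rw [hχ, one_mul, one_pow, h4, MulChar.one_apply (h20.isUnit.pow 2), one_mul]
  by_cases hχφ : χ * φ = 1
  · have : χ = φ := by
      rw [eq_inv_of_mul_eq_one_left hχφ, inv_eq_iff_mul_eq_one, ← sq, h2]
    rw [this, ← sq φ, h2, h4, map_pow, ← MulChar.pow_apply' _ two_ne_zero, h2,
      MulChar.one_apply h20.isUnit]
    ring
  by_cases hχ2 : χ ^ 2 = 1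
  · have : χ = φ := by
      classical
      rw [MulChar.eq_quadraticChar_ringHomComp hF hχ hχ2,
        MulChar.eq_quadraticChar_ringHomComp hF h1 h2]
    rw [this, ← sq, h2] at hχφ
    exact absurd rfl hχφ
  have e1 := jacobiSum_mul_nontrivial (sq χ ▸ hχ2) ψ
  have e2 := jacobiSum_mul_nontrivial hχφ ψ
  rw [← apply_four_mul_jacobiSum_self hF h1 h2 hχ] at e2
  rw [← sq χ] at e1
  refine mul_left_cancel₀ (gaussSum_ne_zero hψ χ) ?_
  linear_combination (-gaussSum (χ * φ) ψ * χ 4) * e1 + gaussSum (χ ^ 2) ψ * e2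

/-- The Hasse–Davenport product formula for characters of order four. -/
theorem apply_four_pow_four_mul_gaussSum_mul (hF : ringChar F ≠ 2) {ψ : AddChar F ℂ}
    (hψ : ψ.IsPrimitive) {A : MulChar F ℂ} (h2 : A ^ 2 ≠ 1) (h4 : A ^ 4 = 1) (χ : MulChar F ℂ) :
    χ 4 ^ 4 * (gaussSum χ ψ * gaussSum (χ * A) ψ * gaussSum (χ * A ^ 2) ψ *
        gaussSum (χ * A ^ 3) ψ) =
      gaussSum (χ ^ 4) ψ * (gaussSum A ψ * gaussSum (A ^ 2) ψ * gaussSum (A ^ 3) ψ) := by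
  have h22 : (A ^ 2) ^ 2 = 1 := by rw [← pow_mul, h4]
  have h20 : (2 : F) ≠ 0 := Ring.two_ne_zero hF
  have h40 : A 4 ≠ 0 := by
    rw [MulChar.apply_ne_zero_iff, show (4 : F) = 2 ^ 2 by norm_num]
    exact h20.isUnit.pow 2
  have hd := apply_four_mul_gaussSum_mul hF hψ h2 h22
  have e1 := hd χ
  have e2 := hd (χ * A)
  have e3 := hd (χ ^ 2)
  have e4 := hd A
  rw [MulChar.mul_apply, mul_assoc χ, ← pow_succ', mul_pow] at e2
  rw [← pow_mul, MulChar.pow_apply' _ two_ne_zero] at e3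
  rw [← pow_succ'] at e4
  norm_num at e2 e3 e4
  refine mul_left_cancel₀ h40 ?_
  linear_combination χ 4 ^ 2 * (χ 4 * A 4 * gaussSum (χ * A) ψ * gaussSum (χ * A ^ 3) ψ * e1 +
    gaussSum (χ ^ 2) ψ * gaussSum (A ^ 2) ψ * e2) + gaussSum (A ^ 2) ψ ^ 2 * e3 -
    gaussSum (χ ^ 4) ψ * gaussSum (A ^ 2) ψ * e4

end HasseDavenport

section HypergeometricTerm

variable {F : Type*} [Field F] [Fintype F]

theorem jacB_mul_self {θ : AddChar F ℂ} {B : MulChar F ℂ} (hB : B ≠ 1) (χ : MulChar F ℂ) :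
    (Fintype.card F : ℂ) * (gaussSum B θ * jacB (B * χ) χ) =
      χ (-1) * (gaussSum (B * χ) θ * gaussSum χ⁻¹ θ) := by
  have hq : (Fintype.card F : ℂ) ≠ 0 := Nat.cast_ne_zero.mpr Fintype.card_ne_zero
  have h : B * χ * χ⁻¹ = B := mul_inv_cancel_right B χ
  rw [← jacobiSum_mul_nontrivial (h.symm ▸ hB) θ, h, jacB, jacobiSum]
  field_simp

theorem gaussSum_prod_sq {θ : AddChar F ℂ} (hθ : θ.IsPrimitive) {A : MulChar F ℂ}
    (h2 : A ^ 2 ≠ 1) (h4 : A ^ 4 = 1) :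
    (gaussSum A θ * gaussSum (A ^ 2) θ * gaussSum (A ^ 3) θ) ^ 2 = (Fintype.card F : ℂ) ^ 3 := by
  classical
  have h1 : A ≠ 1 := fun h => h2 (by rw [h, one_pow])
  have i1 : A⁻¹ = A ^ 3 := inv_eq_of_mul_eq_one_right (by rw [← pow_succ', h4])
  have i2 : (A ^ 2)⁻¹ = A ^ 2 := inv_eq_of_mul_eq_one_right (by rw [← pow_add, h4])
  have e1 := gaussSum_mul_gaussSum_inv hθ A
  have e2 := gaussSum_mul_gaussSum_inv hθ (A ^ 2)
  rw [i1, if_neg h1] at e1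
  rw [i2, if_neg h2, MulChar.pow_apply' _ two_ne_zero, apply_neg_one_sq, one_mul] at e2
  calc _ = (gaussSum A θ * gaussSum (A ^ 3) θ) ^ 2 *
        (gaussSum (A ^ 2) θ * gaussSum (A ^ 2) θ) := by ring
    _ = _ := by rw [e1, e2, mul_pow, apply_neg_one_sq]; ring

theorem card_pow_three_mul_jacB_prod [DecidableEq (MulChar F ℂ)] (hF : ringChar F ≠ 2)
    {θ : AddChar F ℂ} (hθ : θ.IsPrimitive) {A : MulChar F ℂ} (h2 : A ^ 2 ≠ 1) (h4 : A ^ 4 = 1)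
    (lam : F) (χ : MulChar F ℂ) :
    (Fintype.card F : ℂ) ^ 3 * ((Fintype.card F : ℂ) ^ 3 * (jacB (A * χ⁻¹) χ⁻¹ *
        jacB (A ^ 2 * χ⁻¹) (1 * χ⁻¹) * jacB (A ^ 3 * χ⁻¹) (1 * χ⁻¹) * χ⁻¹ (lam ^ 4)⁻¹)) =
      gaussSum χ θ ^ 4 / gaussSum (χ ^ 4) θ * (χ ^ 4) (4 * lam) *
        ((if χ * A = 1 then 1 else (Fintype.card F : ℂ)) *
          (if χ * A ^ 2 = 1 then 1 else (Fintype.card F : ℂ)) *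
          (if χ * A ^ 3 = 1 then 1 else (Fintype.card F : ℂ))) := by
  have h1 : A ≠ 1 := fun h => h2 (by rw [h, one_pow])
  have h3 : A ^ 3 ≠ 1 := fun h => h1 (by rw [← h4, pow_succ, h, one_mul])
  have i1 : (χ * A)⁻¹ = A ^ 3 * χ⁻¹ :=
    inv_eq_of_mul_eq_one_right (by rw [mul_comm χ, mul_mul_mul_comm, ← pow_succ', h4]; simp)
  have i2 : (χ * A ^ 2)⁻¹ = A ^ 2 * χ⁻¹ :=
    inv_eq_of_mul_eq_one_right (by rw [mul_comm χ, mul_mul_mul_comm, ← pow_add, h4]; simp)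
  have i3 : (χ * A ^ 3)⁻¹ = A * χ⁻¹ :=
    inv_eq_of_mul_eq_one_right (by rw [mul_comm χ, mul_mul_mul_comm, ← pow_succ, h4]; simp)
  have e1 := gaussSum_mul_gaussSum_inv hθ (χ * A)
  have e2 := gaussSum_mul_gaussSum_inv hθ (χ * A ^ 2)
  have e3 := gaussSum_mul_gaussSum_inv hθ (χ * A ^ 3)
  have j1 := jacB_mul_self (θ := θ) h1 χ⁻¹
  have j2 := jacB_mul_self (θ := θ) h2 χ⁻¹
  have j3 := jacB_mul_self (θ := θ) h3 χ⁻¹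
  have hinv : χ⁻¹ (-1) = χ (-1) := by rw [MulChar.inv_apply', inv_neg, inv_one]
  rw [inv_inv, hinv] at j1 j2 j3
  rw [i1, MulChar.mul_apply] at e1
  rw [i2, MulChar.mul_apply, MulChar.pow_apply' _ two_ne_zero] at e2
  rw [i3, MulChar.mul_apply, MulChar.pow_apply' _ three_ne_zero] at e3
  have hd := apply_four_pow_four_mul_gaussSum_mul hF hθ h2 h4 χ
  have hG := gaussSum_prod_sq hθ h2 h4
  have hs := apply_neg_one_sq χ
  have ha := apply_neg_one_sq A
  rw [one_mul, MulChar.inv_apply', inv_inv, MulChar.pow_apply' _ four_ne_zero, map_mul, map_pow]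
  have n := gaussSum_ne_zero hθ
  have nw := n (χ ^ 4)
  have nc := mul_ne_zero (mul_ne_zero (mul_ne_zero (n A) (n (A ^ 2))) (n (A ^ 3)))
    (mul_ne_zero (mul_ne_zero (n (χ * A)) (n (χ * A ^ 2))) (n (χ * A ^ 3)))
  generalize (if χ * A = 1 then 1 else (Fintype.card F : ℂ)) = r1 at *
  generalize (if χ * A ^ 2 = 1 then 1 else (Fintype.card F : ℂ)) = r2 at *
  generalize (if χ * A ^ 3 = 1 then 1 else (Fintype.card F : ℂ)) = r3 at *
  generalize jacB (A * χ⁻¹) χ⁻¹ = J1 at *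
  generalize jacB (A ^ 2 * χ⁻¹) χ⁻¹ = J2 at *
  generalize jacB (A ^ 3 * χ⁻¹) χ⁻¹ = J3 at *
  generalize gaussSum (A * χ⁻¹) θ = b1 at *
  generalize gaussSum (A ^ 2 * χ⁻¹) θ = b2 at *
  generalize gaussSum (A ^ 3 * χ⁻¹) θ = b3 at *
  generalize gaussSum (χ * A) θ = a1 at *
  generalize gaussSum (χ * A ^ 2) θ = a2 at *
  generalize gaussSum (χ * A ^ 3) θ = a3 at *
  generalize gaussSum A θ = G1 at *
  generalize gaussSum (A ^ 2) θ = G2 at *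
  generalize gaussSum (A ^ 3) θ = G3 at *
  generalize gaussSum (χ ^ 4) θ = w at *
  generalize gaussSum χ θ = g at *
  generalize (Fintype.card F : ℂ) = q at *
  generalize χ (-1) = s at *
  generalize A (-1) = α at *
  generalize χ 4 = c at *
  generalize χ lam = l at *
  refine mul_left_cancel₀ nc ?_
  have hsα : s ^ 6 * α ^ 6 = 1 := by
    rw [show s ^ 6 * α ^ 6 = (s ^ 2) ^ 3 * (α ^ 2) ^ 3 by ring, hs, ha]; norm_num
  calc _ = q ^ 3 * l ^ 4 * (a1 * a2 * a3) *
        ((q * (G1 * J1)) * (q * (G2 * J2)) * (q * (G3 * J3))) := by ring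
    _ = q ^ 3 * l ^ 4 * s ^ 3 * g ^ 3 * ((a1 * b3) * (a2 * b2) * (a3 * b1)) := by
        rw [j1, j2, j3]; ring
    _ = q ^ 3 * l ^ 4 * g ^ 3 * (r1 * r2 * r3) * (s ^ 6 * α ^ 6) := by
        rw [e1, e2, e3]; ring
    _ = (G1 * G2 * G3) * g ^ 3 * l ^ 4 * (r1 * r2 * r3) * (w * (G1 * G2 * G3)) / w := by
        rw [hsα, ← hG]; field_simp
    _ = _ := by rw [← hd]; ring

theorem gauss_term_sub_greene_term [DecidableEq (MulChar F ℂ)] (hF : ringChar F ≠ 2)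
    {θ : AddChar F ℂ} (hθ : θ.IsPrimitive) {A : MulChar F ℂ} (h2 : A ^ 2 ≠ 1) (h4 : A ^ 4 = 1)
    {lam : F} (hlam : lam ≠ 0) (χ : MulChar F ℂ) :
    gaussSum χ θ ^ 4 / gaussSum (χ ^ 4) θ * (χ ^ 4) (4 * lam) -
        (Fintype.card F : ℂ) ^ 3 * (jacB (A * χ⁻¹) χ⁻¹ * jacB (A ^ 2 * χ⁻¹) (1 * χ⁻¹) *
          jacB (A ^ 3 * χ⁻¹) (1 * χ⁻¹) * χ⁻¹ (lam ^ 4)⁻¹) =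
      ∑ i ∈ Finset.Icc 1 3, if χ = A ^ i then
        -(1 - 1 / (Fintype.card F : ℂ)) * gaussSum (A ^ i) θ ^ 4 else 0 := by
  have h1 : A ≠ 1 := fun h => h2 (by rw [h, one_pow])
  have h3 : A ^ 3 ≠ 1 := fun h => h1 (by rw [← h4, pow_succ, h, one_mul])
  have hq : (Fintype.card F : ℂ) ≠ 0 := Nat.cast_ne_zero.mpr Fintype.card_ne_zero
  have h := card_pow_three_mul_jacB_prod hF hθ h2 h4 lam χ
  have k1 : χ * A = 1 ↔ χ = A ^ 3 := by
    rw [mul_eq_one_iff_eq_inv, inv_eq_of_mul_eq_one_right (b := A ^ 3) (by rw [← pow_succ', h4])]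
  have k2 : χ * A ^ 2 = 1 ↔ χ = A ^ 2 := by
    rw [mul_eq_one_iff_eq_inv, inv_eq_of_mul_eq_one_right (b := A ^ 2) (by rw [← pow_add, h4])]
  have k3 : χ * A ^ 3 = 1 ↔ χ = A := by
    rw [mul_eq_one_iff_eq_inv, inv_eq_of_mul_eq_one_right (b := A) (by rw [← pow_succ, h4])]
  have n12 : A ≠ A ^ 2 := by simpa [sq] using h1
  have n13 : A ≠ A ^ 3 := by simpa [pow_succ'] using h2
  have n23 : A ^ 2 ≠ A ^ 3 := by simpa [pow_succ'] using h1
  have hT : χ ^ 4 = 1 → gaussSum χ θ ^ 4 / gaussSum (χ ^ 4) θ * (χ ^ 4) (4 * lam) =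
      -gaussSum χ θ ^ 4 := by
    intro hχ
    have h40 : (4 : F) ≠ 0 := by
      rw [show (4 : F) = 2 ^ 2 by norm_num]
      exact pow_ne_zero 2 (Ring.two_ne_zero hF)
    rw [hχ, gaussSum_one_left (ne_one_of_isPrimitive hθ),
      MulChar.one_apply (mul_ne_zero h40 hlam).isUnit]
    ring
  have hIcc : Finset.Icc 1 3 = {1, 2, 3} := by decide
  rw [hIcc, Finset.sum_insert (by decide), Finset.sum_pair (by decide), pow_one]
  simp only [k1, k2, k3] at h
  refine mul_left_cancel₀ (pow_ne_zero 3 hq) ?_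
  rw [mul_sub, h]
  by_cases c1 : χ = A
  · rw [hT (by rw [c1, h4])]
    simp only [c1, n12, n13, if_true, if_false]
    field_simp
    ring
  by_cases c2 : χ = A ^ 2
  · rw [hT (by rw [c2, ← pow_mul, mul_comm, pow_mul, h4, one_pow])]
    simp only [c2, n12.symm, n23, if_true, if_false]
    field_simp
    ring
  by_cases c3 : χ = A ^ 3
  · rw [hT (by rw [c3, ← pow_mul, mul_comm, pow_mul, h4, one_pow])]
    simp only [c3, n13.symm, n23.symm, if_true, if_false]
    field_simp
    ring
  simp only [c1, c2, c3, if_false]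
  ring

end HypergeometricTerm

theorem exists_isPrimitive_eq_stdAddChar {F : Type*} [Field F] [Fintype F] (p : ℕ) [Fact p.Prime]
    [CharP F p] [Algebra (ZMod p) F] {ζ : ℂ} (hζ : IsPrimitiveRoot ζ p) :
    ∃ θ : AddChar F ℂ, θ.IsPrimitive ∧ ∀ x, θ x = stdAddChar p ζ x := by
  have hp : p.Prime := Fact.out
  refine ⟨(AddChar.zmodChar p hζ.pow_eq_one).compAddMonoidHom
    (Algebra.trace (ZMod p) F).toAddMonoidHom, AddChar.IsPrimitive.of_ne_one fun h => ?_,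
    fun x => rfl⟩
  obtain ⟨x, hx⟩ := Algebra.trace_surjective (ZMod p) F 1
  have h1 : ζ ^ (Algebra.trace (ZMod p) F x).val = 1 := DFunLike.congr_fun h x
  have : Fact (1 < p) := ⟨hp.one_lt⟩
  rw [hx, ZMod.val_one, pow_one] at h1
  exact hζ.ne_one hp.one_lt h1

/-- Proposition 4.3: for `q ≡ 1 (mod 4)`, `t = (q-1)/4`, `T` a generator of the character
group of `F_q^×`, and `λ ∈ F_q^×`:
`S₀ = (1/(q-1))·∑_{j=0}^{q-2} (g(T^j)⁴/g(T^{4j}))·T^{4j}(4λ)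
    = -(1/q)·∑_{i=1}^{3} g(T^{it})⁴ + q²·₃F₂(T^t, T^{2t}, T^{3t}; ε, ε | 1/λ⁴)`. -/
theorem S0000_eq
    (F : Type*) [Field F] [Fintype F] (p : ℕ) [Fact p.Prime] [CharP F p] [Algebra (ZMod p) F]
    (ζ : ℂ) (hζ : IsPrimitiveRoot ζ p)
    (q t : ℕ) (hq : q = Fintype.card F) (hq4 : q % 4 = 1) (ht : t = (q - 1) / 4)
    (T : MulChar F ℂ) (hT : ∀ χ : MulChar F ℂ, χ ∈ Subgroup.zpowers T)
    (lam : F) (hlam : lam ≠ 0) :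
    (1 / ((q : ℂ) - 1)) *
        ∑ j ∈ Finset.range (q - 1),
          gaussSum' p ζ (T ^ j) ^ 4 / gaussSum' p ζ (T ^ (4 * j)) * (T ^ (4 * j)) (4 * lam) =
      -(1 / (q : ℂ)) * ∑ i ∈ Finset.Icc 1 3, gaussSum' p ζ (T ^ (i * t)) ^ 4 +
        (q : ℂ) ^ 2 * greene3F2 (T ^ t) (T ^ (2 * t)) (T ^ (3 * t)) 1 1 (lam ^ 4)⁻¹ := by
  classical
  have hF : ringChar F ≠ 2 := fun h => by
    have := FiniteField.even_card_iff_char_two.mp h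
    omega
  have hcard : Nat.card (MulChar F ℂ) = q - 1 := by
    rw [MulChar.card_eq_card_units_of_hasEnoughRootsOfUnity, Nat.card_eq_fintype_card,
      Fintype.card_units, hq]
  have hq1 : 1 < q := hq ▸ Fintype.one_lt_card
  have hord : orderOf T = q - 1 := (orderOf_eq_card_of_forall_mem_zpowers hT).trans hcard
  have hqt : q - 1 = t * 4 := by omega
  have hA : orderOf (T ^ t) = 4 := by
    rw [orderOf_pow_of_dvd (by omega) (hord ▸ hqt ▸ dvd_mul_right t 4), hord, hqt]
    exact Nat.mul_div_cancel_left 4 (by omega)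
  have h4 : (T ^ t) ^ 4 = 1 := hA ▸ pow_orderOf_eq_one (T ^ t)
  have h2 : (T ^ t) ^ 2 ≠ 1 := fun h => by
    have := Nat.le_of_dvd two_pos (orderOf_dvd_of_pow_eq_one h)
    omega
  obtain ⟨θ, hθ, hθζ⟩ := exists_isPrimitive_eq_stdAddChar (F := F) p hζ
  have hg : ∀ χ : MulChar F ℂ, gaussSum' p ζ χ = gaussSum χ θ := fun χ => by
    simp only [gaussSum', gaussSum, hθζ]
  have : Fintype (MulChar F ℂ) := Fintype.ofFinite _
  have hrange : ∀ f : MulChar F ℂ → ℂ, ∑ j ∈ Finset.range (q - 1), f (T ^ j) = ∑ χ, f χ := by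
    intro f
    rw [← IsCyclic.image_range_orderOf hT, hord, Finset.sum_image]
    rw [← hord, Finset.coe_range]
    exact pow_injOn_Iio_orderOf
  have hsum := Finset.sum_congr (rfl : (Finset.univ : Finset (MulChar F ℂ)) = _)
    fun χ _ => gauss_term_sub_greene_term hF hθ h2 h4 hlam χ
  rw [Finset.sum_sub_distrib, ← Finset.mul_sum, Finset.sum_comm] at hsum
  simp only [Finset.sum_ite_eq', Finset.mem_univ, if_true, ← Finset.mul_sum] at hsum
  have hinv := Equiv.sum_comp (Equiv.inv (MulChar F ℂ)) fun χ => jacB (T ^ t * χ) χ *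
    jacB ((T ^ t) ^ 2 * χ) (1 * χ) * jacB ((T ^ t) ^ 3 * χ) (1 * χ) * χ (lam ^ 4)⁻¹
  simp only [Equiv.inv_apply] at hinv
  rw [hinv] at hsum
  have hq0 : (q : ℂ) ≠ 0 := Nat.cast_ne_zero.mpr (by omega)
  have hq10 : (q : ℂ) - 1 ≠ 0 := sub_ne_zero.mpr (by exact_mod_cast hq1.ne')
  have hpow : ∀ n, T ^ (n * t) = (T ^ t) ^ n := fun n => by rw [mul_comm, pow_mul]
  have hpow4 : ∀ j, T ^ (4 * j) = (T ^ j) ^ 4 := fun j => by rw [mul_comm, pow_mul]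
  simp only [hg, hpow, hpow4, greene3F2, finsum_eq_sum_of_fintype]
  rw [hrange fun χ => gaussSum χ θ ^ 4 / gaussSum (χ ^ 4) θ * (χ ^ 4) (4 * lam),
    sub_eq_iff_eq_add.mp hsum, ← hq]
  field_simp
end

section
/- Let q be a prime power with q ≡ 1 (mod 4), set t = (q−1)/4, let T be a generator of the group of multiplicative characters of F_q^×, and let λ ∈ F_q^×. Define S₁ := (12/(q−1))·Σ_{j=0}^{q−2} (g(T^j)·g(T^{t+j})²·g(T^{2t+j}) / g(T^{4j}))·T^{4j}(4λ). Then S₁ = 12q·T^t(−1)·(T^{2t}(1−λ⁴) − 1). -/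
namespace MulChar

open Finset

variable {F : Type*} [Field F]

theorem apply_sq_of_sq_eq_one {φ : MulChar F ℂ} (hφ2 : φ ^ 2 = 1) {x : F}
    (hx : x ≠ 0) : φ (x ^ 2) = 1 := by
  rw [map_pow, ← pow_apply' _ two_ne_zero, hφ2, one_apply hx.isUnit]

theorem apply_two_eq_apply_neg_one (hF : ringChar F ≠ 2) {ψ φ : MulChar F ℂ} (hψ : ψ ^ 2 = φ)
    (hφ2 : φ ^ 2 = 1) {i : F} (hi : i ^ 2 = -1) : φ 2 = ψ (-1) := by
  have h2 : (2 : F) ≠ 0 := Ring.two_ne_zero hF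
  have h4 : (1 + i) ^ 4 = -1 * 2 ^ 2 := by linear_combination (i ^ 2 + 4 * i + 5) * hi
  have hi0 : 1 + i ≠ 0 := by
    intro h
    rw [h] at h4
    simp [h2] at h4
  have h : ψ ((1 + i) ^ 4) = 1 := by
    rw [show (1 + i) ^ 4 = ((1 + i) ^ 2) ^ 2 by ring, map_pow, ← pow_apply' _ two_ne_zero, hψ,
      apply_sq_of_sq_eq_one hφ2 hi0]
  rw [h4, map_mul, map_pow, ← pow_apply' _ two_ne_zero, hψ] at h
  have hneg : ψ (-1) * ψ (-1) = 1 := by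
    rw [← map_mul]
    simp
  linear_combination ψ (-1) * h - φ 2 * hneg

variable [Fintype F]

/-- A finite field has at most one character of order exactly two. -/
theorem eq_of_sq_eq_one {χ φ : MulChar F ℂ} (hχ1 : χ ≠ 1) (hχ2 : χ ^ 2 = 1)
    (hφ1 : φ ≠ 1) (hφ2 : φ ^ 2 = 1) : χ = φ := by
  obtain ⟨g, hg⟩ := IsCyclic.exists_generator (α := Fˣ)
  have key : ∀ η : MulChar F ℂ, η ≠ 1 → η ^ 2 = 1 → η g = -1 := by
    intro η h1 h2
    have h : η g ^ 2 = 1 := by rw [← pow_apply_coe, h2, one_apply_coe]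
    refine (sq_eq_one_iff.mp h).resolve_left fun h3 ↦ ?_
    exact h1 ((eq_iff hg η 1).mpr (by rw [h3, one_apply_coe]))
  exact (eq_iff hg χ φ).mpr (by rw [key χ hχ1 hχ2, key φ hφ1 hφ2])

theorem quadratic_eq_ringHomComp_quadraticChar [DecidableEq F] (hF : ringChar F ≠ 2)
    {φ : MulChar F ℂ} (hφ1 : φ ≠ 1) (hφ2 : φ ^ 2 = 1) :
    φ = (quadraticChar F).ringHomComp (Int.castRingHom ℂ) := by
  refine eq_of_sq_eq_one hφ1 hφ2 ?_ ?_
  · exact (ringHomComp_ne_one_iff (Int.cast_injective (α := ℂ))).mpr (quadraticChar_ne_one hF)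
  · exact ((quadraticChar_isQuadratic F).comp _).sq_eq_one

theorem sum_comp_sq (hF : ringChar F ≠ 2) {φ : MulChar F ℂ} (hφ1 : φ ≠ 1) (hφ2 : φ ^ 2 = 1)
    (f : F → ℂ) : ∑ y, f (y ^ 2) = ∑ v, f v * (1 + φ v) := by
  classical
  rw [← sum_fiberwise univ (fun y : F ↦ y ^ 2)]
  refine sum_congr rfl fun v _ ↦ ?_
  rw [sum_congr rfl (g := fun _ ↦ f v) (fun y hy ↦ by rw [(mem_filter.mp hy).2]),
    sum_const, nsmul_eq_mul, mul_comm]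
  congr 1
  have h := quadraticChar_card_sqrts hF v
  rw [Set.toFinset_ofPred] at h
  rw [quadratic_eq_ringHomComp_quadraticChar hF hφ1 hφ2, ringHomComp_apply]
  have h' := congrArg (Int.cast : ℤ → ℂ) h
  push_cast at h'
  rw [h', add_comm]
  rfl

theorem jacobiSum_quadratic (hF : ringChar F ≠ 2) {φ : MulChar F ℂ} (hφ1 : φ ≠ 1)
    (hφ2 : φ ^ 2 = 1) {χ : MulChar F ℂ} (hχ : χ ≠ 1) :
    jacobiSum χ φ = χ 4 * jacobiSum χ χ := by
  have h2 : (2 : F) ≠ 0 := Ring.two_ne_zero hF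
  have h : χ 4 * jacobiSum χ χ = ∑ y : F, χ (1 - y ^ 2) := by
    rw [jacobiSum, mul_sum]
    have hb : Function.Bijective fun x : F ↦ 1 - 2 * x :=
      (Finite.injective_iff_bijective).mp fun a b hab ↦ by simpa [h2] using hab
    refine Fintype.sum_bijective _ hb _ _ fun x ↦ ?_
    rw [← map_mul, ← map_mul]
    congr 1
    ring
  have hs : ∑ v : F, χ (1 - v) = 0 := by
    rw [← sum_eq_zero_of_ne_one hχ]
    exact Equiv.sum_comp (Equiv.subLeft (1 : F)) χ
  rw [h, sum_comp_sq hF hφ1 hφ2 (fun v ↦ χ (1 - v))]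
  simp only [mul_add, mul_one, sum_add_distrib]
  rw [hs, zero_add, jacobiSum_comm, jacobiSum]
  exact sum_congr rfl fun _ _ ↦ mul_comm _ _

theorem gaussSum_ne_zero {E : AddChar F ℂ} (hE : E.IsPrimitive) (χ : MulChar F ℂ) :
    gaussSum χ E ≠ 0 := by
  by_cases h : χ = 1
  · rw [h, gaussSum_one_left (by simpa using hE one_ne_zero)]
    simp
  · exact gaussSum_ne_zero_of_nontrivial (by simp) h hE

/-- The Hasse-Davenport product formula for the quadratic character. -/
theorem gaussSum_mul_gaussSum_quadratic (hF : ringChar F ≠ 2) {φ : MulChar F ℂ} (hφ1 : φ ≠ 1)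
    (hφ2 : φ ^ 2 = 1) {E : AddChar F ℂ} (hE : E.IsPrimitive) (χ : MulChar F ℂ) :
    χ 4 * (gaussSum χ E * gaussSum (χ * φ) E) = gaussSum (χ ^ 2) E * gaussSum φ E := by
  have h2 : (2 : F) ≠ 0 := Ring.two_ne_zero hF
  have h4 : (4 : F) = 2 ^ 2 := by norm_num
  by_cases h1 : χ = 1
  · rw [h1, h4, one_apply (h2.isUnit.pow 2)]
    simp
  by_cases hχφ : χ = φ
  · rw [hχφ, h4, map_pow, ← pow_apply' _ two_ne_zero, ← pow_two φ, hφ2, one_apply h2.isUnit]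
    ring
  have hχ2 : χ ^ 2 ≠ 1 := fun h ↦ hχφ (eq_of_sq_eq_one h1 h hφ1 hφ2)
  have hmul : χ * φ ≠ 1 := fun h ↦ hχφ <| by
    rw [← mul_one χ, ← hφ2, pow_two, ← mul_assoc, h, one_mul]
  have e1 := jacobiSum_mul_nontrivial (by rwa [← pow_two]) E (χ := χ) (φ := χ)
  have e2 := jacobiSum_mul_nontrivial hmul E
  rw [jacobiSum_quadratic hF hφ1 hφ2 h1] at e2
  rw [← pow_two χ] at e1
  refine mul_left_cancel₀ (gaussSum_ne_zero hE χ) ?_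
  linear_combination gaussSum (χ ^ 2) E * e2 - χ 4 * gaussSum (χ * φ) E * e1

theorem gaussSum_mul_gaussSum_eq_jacobiSum_sub {φ : MulChar F ℂ} (hφ1 : φ ≠ 1) (hφ2 : φ ^ 2 = 1)
    (hφ : φ (-1) = 1) {E : AddChar F ℂ} (hE : E.IsPrimitive) (η : MulChar F ℂ)
    [DecidableEq (MulChar F ℂ)] :
    gaussSum η E * gaussSum φ E =
      gaussSum (η * φ) E * (jacobiSum η φ - if η = φ then (Fintype.card F : ℂ) - 1 else 0) := by
  have hφφ : φ * φ = 1 := by rw [← pow_two, hφ2]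
  split_ifs with h
  · subst h
    have hinv : η⁻¹ = η := inv_eq_of_mul_eq_one_right hφφ
    have hJ := jacobiSum_nontrivial_inv hφ1
    rw [hinv] at hJ
    rw [hφφ, hJ, hφ, gaussSum_one_left (by simpa using hE one_ne_zero), ← pow_two,
      gaussSum_sq hφ1 (isQuadratic_iff_sq_eq_one.mpr hφ2) hE, hφ]
    ring
  · have hmul : η * φ ≠ 1 := fun h' ↦ h <| by
      rw [← mul_one η, ← hφφ, ← mul_assoc, h', one_mul]
    rw [sub_zero]
    exact (jacobiSum_mul_nontrivial hmul E).symm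

/-- Orthogonality: the sum of `χ a` over all characters `χ` vanishes unless `a = 1`. -/
theorem sum_mulChar_eq [Fintype (MulChar F ℂ)] [DecidableEq F] (a : F) :
    ∑ χ : MulChar F ℂ, χ a = if a = 1 then (Fintype.card (MulChar F ℂ) : ℂ) else 0 := by
  split_ifs with ha
  · simp [ha]
  · obtain ⟨χ, hχ⟩ := exists_apply_ne_one_of_hasEnoughRootsOfUnity F ℂ ha
    refine eq_zero_of_mul_eq_self_left hχ ?_
    simp only [mul_sum, ← mul_apply]
    exact Fintype.sum_bijective _ (Group.mulLeft_bijective χ) _ _ fun _ ↦ rfl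

theorem sum_apply_mul_jacobiSum [Fintype (MulChar F ℂ)] (φ : MulChar F ℂ) {a : F} (ha : a ≠ 0) :
    ∑ χ : MulChar F ℂ, χ a * jacobiSum χ φ = Fintype.card (MulChar F ℂ) * φ (1 - a⁻¹) := by
  classical
  simp only [jacobiSum, mul_sum, ← mul_assoc, ← map_mul]
  rw [sum_comm]
  simp only [← sum_mul, sum_mulChar_eq]
  rw [sum_eq_single a⁻¹]
  · simp [ha]
  · intro b _ hb
    rw [if_neg, zero_mul]
    exact fun h ↦ hb (eq_inv_of_mul_eq_one_right h)
  · simp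

theorem sum_range_pow_eq_sum [Fintype (MulChar F ℂ)] {T : MulChar F ℂ}
    (hT : ∀ χ : MulChar F ℂ, χ ∈ Subgroup.zpowers T) (f : MulChar F ℂ → ℂ) :
    ∑ j ∈ range (orderOf T), f (T ^ j) = ∑ χ, f χ := by
  classical
  rw [← IsCyclic.image_range_orderOf hT, sum_image]
  intro i hi j hj hij
  exact pow_injOn_Iio_orderOf (by simpa using hi) (by simpa using hj) hij

theorem card_eq_card_sub_one [Fintype (MulChar F ℂ)] :
    Fintype.card (MulChar F ℂ) = Fintype.card F - 1 := by
  classical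
  rw [← Nat.card_eq_fintype_card, card_eq_card_units_of_hasEnoughRootsOfUnity,
    Nat.card_eq_fintype_card, Fintype.card_units]

theorem gaussSum_quotient_eq (hF : ringChar F ≠ 2) {ψ φ : MulChar F ℂ} (hψ : ψ ^ 2 = φ)
    (hφ1 : φ ≠ 1) (hφ2 : φ ^ 2 = 1) (hφ : φ (-1) = 1) {E : AddChar F ℂ} (hE : E.IsPrimitive)
    [DecidableEq (MulChar F ℂ)] {lam : F} (hlam : lam ≠ 0) (χ : MulChar F ℂ) :
    gaussSum χ E * gaussSum (χ * ψ) E ^ 2 * gaussSum (χ * φ) E / gaussSum (χ ^ 4) E *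
        (χ ^ 4) (4 * lam) =
      φ 2 * Fintype.card F * ((χ * ψ) (lam ^ 4) *
        (jacobiSum (χ * ψ) φ - if χ * ψ = φ then (Fintype.card F : ℂ) - 1 else 0)) := by
  have h2 : (2 : F) ≠ 0 := Ring.two_ne_zero hF
  have h1 := gaussSum_mul_gaussSum_quadratic hF hφ1 hφ2 hE χ
  have h3 := gaussSum_mul_gaussSum_quadratic hF hφ1 hφ2 hE (χ * ψ)
  have h5 := gaussSum_mul_gaussSum_quadratic hF hφ1 hφ2 hE (χ ^ 2)
  have h6 := gaussSum_mul_gaussSum_eq_jacobiSum_sub hφ1 hφ2 hφ hE (χ * ψ)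
  have h7 := gaussSum_sq hφ1 (isQuadratic_iff_sq_eq_one.mpr hφ2) hE
  have hψ4 : ψ 4 = φ 2 := by
    rw [show (4 : F) = 2 ^ 2 by norm_num, map_pow, ← pow_apply' _ two_ne_zero, hψ]
  have hφ22 : φ 2 * φ 2 = 1 := by rw [← map_mul, ← pow_two, apply_sq_of_sq_eq_one hφ2 h2]
  have hlam4 : (χ * ψ) (lam ^ 4) = χ lam ^ 4 := by
    rw [mul_apply, show ψ (lam ^ 4) = 1 by
      rw [show lam ^ 4 = (lam ^ 2) ^ 2 by ring, map_pow, ← pow_apply' _ two_ne_zero, hψ,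
        apply_sq_of_sq_eq_one hφ2 hlam], map_pow, mul_one]
  rw [mul_apply, hψ4, mul_pow, hψ] at h3
  rw [← pow_mul, pow_apply' _ two_ne_zero] at h5
  rw [hφ, one_mul] at h7
  rw [hlam4, pow_apply' _ four_ne_zero, map_mul]
  have hD := gaussSum_ne_zero hE (χ * ψ * φ)
  have hQ := gaussSum_ne_zero hE (χ ^ 4)
  generalize (jacobiSum (χ * ψ) φ - if χ * ψ = φ then (Fintype.card F : ℂ) - 1 else 0) = J at *
  rw [← h7]
  norm_num at h5
  generalize gaussSum χ E = A at *
  generalize gaussSum (χ * ψ) E = B at *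
  generalize gaussSum (χ * φ) E = C at *
  generalize gaussSum (χ * ψ * φ) E = D at *
  generalize gaussSum (χ ^ 4) E = Q at *
  generalize gaussSum φ E = G at *
  generalize gaussSum (χ ^ 2) E = X at *
  generalize gaussSum (χ ^ 2 * φ) E = Y at *
  have key : χ 4 ^ 4 * φ 2 * (A * B * C * D) = Q * G ^ 3 := by
    linear_combination χ 4 ^ 2 * (χ 4 * φ 2 * B * D) * h1 + χ 4 ^ 2 * X * G * h3 + G ^ 2 * h5
  have key2 : χ 4 ^ 4 * (A * B ^ 2 * C) = φ 2 * G ^ 2 * Q * J := by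
    refine mul_left_cancel₀ hD ?_
    linear_combination φ 2 * B * key + φ 2 * G ^ 2 * Q * h6
      - χ 4 ^ 4 * (A * B ^ 2 * C * D) * hφ22
  rw [div_mul_eq_mul_div, div_eq_iff hQ]
  linear_combination χ lam ^ 4 * key2

theorem sum_gaussSum_quotient (hF : ringChar F ≠ 2) [Fintype (MulChar F ℂ)] {ψ φ : MulChar F ℂ}
    (hψ : ψ ^ 2 = φ) (hφ1 : φ ≠ 1) (hφ2 : φ ^ 2 = 1) {i : F} (hi : i ^ 2 = -1)
    {E : AddChar F ℂ} (hE : E.IsPrimitive) {lam : F} (hlam : lam ≠ 0) :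
    ∑ χ : MulChar F ℂ, gaussSum χ E * gaussSum (χ * ψ) E ^ 2 * gaussSum (χ * φ) E /
        gaussSum (χ ^ 4) E * (χ ^ 4) (4 * lam) =
      ψ (-1) * Fintype.card F * ((Fintype.card F - 1) * (φ (1 - lam ^ 4) - 1)) := by
  classical
  have hi0 : i ≠ 0 := fun h ↦ by simp [h] at hi
  have hφ : φ (-1) = 1 := hi ▸ apply_sq_of_sq_eq_one hφ2 hi0
  have hcard : (Fintype.card (MulChar F ℂ) : ℂ) = Fintype.card F - 1 := by
    rw [card_eq_card_sub_one, Nat.cast_sub Fintype.card_pos, Nat.cast_one]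
  have hφ4 : φ (lam ^ 4) = 1 := by
    rw [show lam ^ 4 = (lam ^ 2) ^ 2 by ring, apply_sq_of_sq_eq_one hφ2 (pow_ne_zero 2 hlam)]
  have hinv : φ (1 - (lam ^ 4)⁻¹) = φ (1 - lam ^ 4) := by
    have h : 1 - (lam ^ 4)⁻¹ = -1 * ((lam ^ 2)⁻¹) ^ 2 * (1 - lam ^ 4) := by
      field_simp
      ring
    rw [h, map_mul, map_mul, hφ, apply_sq_of_sq_eq_one hφ2 (inv_ne_zero (pow_ne_zero 2 hlam)),
      one_mul, one_mul]
  rw [Fintype.sum_equiv (Equiv.mulRight ψ) _ (fun η ↦ φ 2 * Fintype.card F * (η (lam ^ 4) *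
      (jacobiSum η φ - if η = φ then (Fintype.card F : ℂ) - 1 else 0)))
      (gaussSum_quotient_eq hF hψ hφ1 hφ2 hφ hE hlam),
    ← mul_sum, apply_two_eq_apply_neg_one hF hψ hφ2 hi]
  congr 1
  simp only [mul_sub, sum_sub_distrib, mul_ite, mul_zero, sum_ite_eq', mem_univ, if_true]
  rw [sum_apply_mul_jacobiSum φ (pow_ne_zero 4 hlam), hcard, hinv, hφ4]
  ring

end MulChar

/-- The Gauss sums `gaussSum'` are the Gauss sums of a primitive additive character. -/
theorem exists_isPrimitive_gaussSum'_eq {F : Type*} [Field F] [Fintype F] (p : ℕ) [Fact p.Prime]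
    [CharP F p] [Algebra (ZMod p) F] {ζ : ℂ} (hζ : IsPrimitiveRoot ζ p) :
    ∃ E : AddChar F ℂ, E.IsPrimitive ∧ ∀ χ : MulChar F ℂ, gaussSum' p ζ χ = gaussSum χ E := by
  let E : AddChar F ℂ := (AddChar.zmodChar p hζ.pow_eq_one).compAddMonoidHom
    (Algebra.trace (ZMod p) F).toAddMonoidHom
  refine ⟨E, AddChar.IsPrimitive.of_ne_one ?_, fun χ ↦ rfl⟩
  obtain ⟨x, hx⟩ := Algebra.trace_surjective (ZMod p) F 1
  refine AddChar.ne_one_iff.mpr ⟨x, ?_⟩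
  have hp : 1 < p := (Fact.out : p.Prime).one_lt
  have : Fact (1 < p) := ⟨hp⟩
  change ζ ^ (Algebra.trace (ZMod p) F x).val ≠ 1
  rw [hx, ZMod.val_one, pow_one]
  exact hζ.ne_one hp

/-- Proposition 4.4: for `q ≡ 1 (mod 4)`, `t = (q-1)/4`, `T` a generator of the character
group of `F_q^×`, and `λ ∈ F_q^×`:
`S₁ = (12/(q-1))·∑_{j=0}^{q-2} (g(T^j)·g(T^{t+j})²·g(T^{2t+j})/g(T^{4j}))·T^{4j}(4λ)
    = 12q·T^t(-1)·(T^{2t}(1-λ⁴) - 1)`. -/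
theorem S0112_eq
    (F : Type*) [Field F] [Fintype F] (p : ℕ) [Fact p.Prime] [CharP F p] [Algebra (ZMod p) F]
    (ζ : ℂ) (hζ : IsPrimitiveRoot ζ p)
    (q t : ℕ) (hq : q = Fintype.card F) (hq4 : q % 4 = 1) (ht : t = (q - 1) / 4)
    (T : MulChar F ℂ) (hT : ∀ χ : MulChar F ℂ, χ ∈ Subgroup.zpowers T)
    (lam : F) (hlam : lam ≠ 0) :
    (12 / ((q : ℂ) - 1)) *
        ∑ j ∈ Finset.range (q - 1),
          gaussSum' p ζ (T ^ j) * gaussSum' p ζ (T ^ (t + j)) ^ 2 *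
              gaussSum' p ζ (T ^ (2 * t + j)) / gaussSum' p ζ (T ^ (4 * j)) *
            (T ^ (4 * j)) (4 * lam) =
      12 * (q : ℂ) * (T ^ t) (-1 : F) * ((T ^ (2 * t)) (1 - lam ^ 4) - 1) := by
  classical
  have := Fintype.ofFinite (MulChar F ℂ)
  subst hq
  obtain ⟨E, hE, hg⟩ := exists_isPrimitive_gaussSum'_eq (F := F) p hζ
  have hF : ringChar F ≠ 2 := fun h ↦ by
    have := FiniteField.even_card_of_char_two h
    omega
  have hone : 1 < Fintype.card F := Fintype.one_lt_card
  have hord : orderOf T = Fintype.card F - 1 := by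
    rw [orderOf_eq_card_of_forall_mem_zpowers hT, Nat.card_eq_fintype_card,
      MulChar.card_eq_card_sub_one]
  have h4t : 4 * t = orderOf T := by omega
  have hψ : (T ^ t) ^ 2 = T ^ (2 * t) := by rw [← pow_mul, mul_comm]
  have hφ1 : T ^ (2 * t) ≠ 1 := fun h ↦ by
    have := Nat.le_of_dvd (by omega) (orderOf_dvd_of_pow_eq_one h)
    omega
  have hφ2 : (T ^ (2 * t)) ^ 2 = 1 := by
    rw [← pow_mul, show 2 * t * 2 = orderOf T by omega, pow_orderOf_eq_one]
  obtain ⟨i, hi⟩ : IsSquare (-1 : F) := FiniteField.isSquare_neg_one_iff.mpr (by omega)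
  have hsum := MulChar.sum_gaussSum_quotient hF hψ hφ1 hφ2 (i := i) (by rw [hi, pow_two]) hE hlam
  rw [← MulChar.sum_range_pow_eq_sum hT, hord] at hsum
  have hq0 : (Fintype.card F : ℂ) - 1 ≠ 0 := sub_ne_zero.mpr (by exact_mod_cast hone.ne')
  rw [Finset.sum_congr rfl fun j _ ↦ by
    rw [hg, hg, hg, hg, add_comm t, add_comm (2 * t), pow_add, pow_add, mul_comm 4 j,
      pow_mul T j 4],
    hsum]
  field_simp
end
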